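/- arXiv:1607.01697 — 6 statements merged into one kernel-verified Lean document; each statement's English description precedes it below -/
import Mathlib

section
/- For the Lie algebra 𝔬_n = {x ∈ 𝔤𝔩_n(ℂ) : xᵗ + x = 0} of skew-symmetric n×n complex matrices, the Killing form is given by B(x,y) = (n−2)·tr(xy) for all x, y ∈ 𝔬_n. -/
theorem killingForm_so_aux_trace {n : ℕ}
    (F : Matrix (Fin n) (Fin n) ℂ →ₗ[ℂ] Matrix (Fin n) (Fin n) ℂ) :
    LinearMap.trace ℂ _ F = ∑ i, ∑ j, F (Matrix.single i j (1:ℂ)) i j := by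
  rw [LinearMap.trace_eq_matrix_trace ℂ (Matrix.stdBasis ℂ (Fin n) (Fin n)), Matrix.trace,
    Fintype.sum_prod_type]
  refine Finset.sum_congr rfl fun i _ => Finset.sum_congr rfl fun j _ => ?_
  rw [Matrix.diag_apply, LinearMap.toMatrix_apply, Matrix.stdBasis_eq_single]
  rfl

theorem killingForm_so_aux_entry {n : ℕ} (a b : Matrix (Fin n) (Fin n) ℂ) (i j k l : Fin n) :
    (a * Matrix.single k l (1:ℂ) * b : Matrix (Fin n) (Fin n) ℂ) i j = a i k * b l j := by
  rw [Matrix.mul_apply, Finset.sum_eq_single l]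
  · simp
  · intro m _ hm
    simp [Matrix.mul_single_apply_of_ne, hm]
  · simp

theorem killingForm_so_aux_sum {n : ℕ} (a b : Matrix (Fin n) (Fin n) ℂ) :
    ∑ i, ∑ j, (a * Matrix.single i j (1:ℂ) * b : Matrix (Fin n) (Fin n) ℂ) i j = a.trace * b.trace := by
  simp only [killingForm_so_aux_entry, Matrix.trace, Matrix.diag_apply, Finset.sum_mul_sum]

theorem killingForm_so_aux_sum' {n : ℕ} (a b : Matrix (Fin n) (Fin n) ℂ) :
    ∑ i, ∑ j, (a * Matrix.single j i (1:ℂ) * b : Matrix (Fin n) (Fin n) ℂ) i j = (a * b.transpose).trace := by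
  simp only [killingForm_so_aux_entry]
  simp only [Matrix.trace, Matrix.diag_apply, Matrix.mul_apply, Matrix.transpose_apply]

theorem killingForm_so_aux_mem {n : ℕ} (z : Matrix (Fin n) (Fin n) ℂ) :
    z ∈ skewAdjointMatricesLieSubalgebra (1 : Matrix (Fin n) (Fin n) ℂ) ↔ z.transpose = -z := by
  rw [mem_skewAdjointMatricesLieSubalgebra, mem_skewAdjointMatricesSubmodule]
  simp [Matrix.IsSkewAdjoint, Matrix.IsAdjointPair]

/-- The projection onto the skew-symmetric matrices. -/
noncomputable def killingForm_so_aux_proj (n : ℕ) : Matrix (Fin n) (Fin n) ℂ →ₗ[ℂ]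
    skewAdjointMatricesLieSubalgebra (1 : Matrix (Fin n) (Fin n) ℂ) where
  toFun z := ⟨(1 / 2 : ℂ) • (z - z.transpose), by
    rw [killingForm_so_aux_mem]
    simp [← smul_neg]⟩
  map_add' a b := by
    ext1
    simp [← smul_add]
    abel
  map_smul' c a := by
    ext1
    simp [smul_comm c, smul_sub]

/-- The Killing form of `𝔬_n`, the Lie algebra of skew-symmetric `n × n` complex
matrices (`xᵗ + x = 0`), is given by `B(x, y) = (n − 2)·tr(xy)`. -/
theorem killingForm_so (n : ℕ)
    (x y : skewAdjointMatricesLieSubalgebra (1 : Matrix (Fin n) (Fin n) ℂ)) :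
    killingForm ℂ (skewAdjointMatricesLieSubalgebra (1 : Matrix (Fin n) (Fin n) ℂ)) x y
      = ((n : ℂ) - 2) * ((x : Matrix (Fin n) (Fin n) ℂ) * (y : Matrix (Fin n) (Fin n) ℂ)).trace := by
  let L := skewAdjointMatricesLieSubalgebra (1 : Matrix (Fin n) (Fin n) ℂ)
  let P := killingForm_so_aux_proj n
  let I : L →ₗ[ℂ] Matrix (Fin n) (Fin n) ℂ :=
    (skewAdjointMatricesSubmodule (1 : Matrix (Fin n) (Fin n) ℂ)).subtype
  let A : L →ₗ[ℂ] L := LieAlgebra.ad ℂ L x ∘ₗ LieAlgebra.ad ℂ L y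
  have hPI : P ∘ₗ (I ∘ₗ A) = A := by
    ext1 z
    have h := (killingForm_so_aux_mem _).1 (A z).2
    apply Subtype.ext
    change (1 / 2 : ℂ) • ((A z : Matrix (Fin n) (Fin n) ℂ)
      - (A z : Matrix (Fin n) (Fin n) ℂ).transpose) = A z
    rw [h, sub_neg_eq_add, ← two_smul ℂ, smul_smul]
    norm_num
  have h1 : killingForm ℂ L x y = LinearMap.trace ℂ L A := by
    rw [killingForm_apply_apply]
  have hx := (killingForm_so_aux_mem _).1 x.2
  have hy := (killingForm_so_aux_mem _).1 y.2
  refine h1.trans ?_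
  rw [← hPI, LinearMap.trace_comp_comm', killingForm_so_aux_trace]
  obtain ⟨a, ha⟩ := x
  obtain ⟨b, hb⟩ := y
  simp only at hx hy ⊢
  have key : ∀ i j : Fin n, ((I ∘ₗ A) ∘ₗ P) (Matrix.single i j (1:ℂ)) i j = (1 / 2 : ℂ) *
      ((a * b * Matrix.single i j (1:ℂ) * 1 : Matrix (Fin n) (Fin n) ℂ) i j - (a * Matrix.single i j (1:ℂ) * b : Matrix (Fin n) (Fin n) ℂ) i j
        - (b * Matrix.single i j (1:ℂ) * a) i j + (1 * Matrix.single i j (1:ℂ) * (b * a) : Matrix (Fin n) (Fin n) ℂ) i j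
      - ((a * b * Matrix.single j i (1:ℂ) * 1 : Matrix (Fin n) (Fin n) ℂ) i j - (a * Matrix.single j i (1:ℂ) * b : Matrix (Fin n) (Fin n) ℂ) i j
        - (b * Matrix.single j i (1:ℂ) * a) i j + (1 * Matrix.single j i (1:ℂ) * (b * a) : Matrix (Fin n) (Fin n) ℂ) i j)) := by
    intro i j
    have : ((I ∘ₗ A) ∘ₗ P) (Matrix.single i j (1:ℂ)) =
      a * (b * ((1 / 2 : ℂ) • (Matrix.single i j (1:ℂ) - (Matrix.single i j (1:ℂ)).transpose))
        - ((1 / 2 : ℂ) • (Matrix.single i j (1:ℂ) - (Matrix.single i j (1:ℂ)).transpose)) * b)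
      - (b * ((1 / 2 : ℂ) • (Matrix.single i j (1:ℂ) - (Matrix.single i j (1:ℂ)).transpose))
        - ((1 / 2 : ℂ) • (Matrix.single i j (1:ℂ) - (Matrix.single i j (1:ℂ)).transpose)) * b) * a :=
      rfl
    rw [this, Matrix.transpose_single]
    simp only [Matrix.mul_smul, Matrix.smul_mul, ← smul_sub]
    rw [Matrix.smul_apply, smul_eq_mul]
    simp only [← Matrix.sub_apply, ← Matrix.add_apply]
    congr 1
    refine congrFun (congrFun ?_ i) j
    noncomm_ring
  simp only [key, ← Finset.mul_sum, Finset.sum_add_distrib, Finset.sum_sub_distrib,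
    killingForm_so_aux_sum, killingForm_so_aux_sum']
  have ta : a.trace = 0 := by
    have := congrArg Matrix.trace hx
    rw [Matrix.trace_transpose, Matrix.trace_neg] at this
    exact self_eq_neg.1 this
  rw [Matrix.transpose_mul, hx, hy, ta]
  simp only [Matrix.trace_mul_comm b a, Matrix.trace_one, Matrix.transpose_one, mul_one, one_mul,
    Matrix.mul_neg, Matrix.neg_mul, neg_neg, Matrix.trace_neg, Fintype.card_fin]
  ring
end

section
/- (Jacobson–Morozov) Let 𝔤 be a finite-dimensional semisimple Lie algebra over ℂ and let e ∈ 𝔤 be a nonzero nilpotent element (i.e. ad_e is a nilpotent endomorphism of 𝔤). Then e can be included in an sl₂-triple: there exist h, f ∈ 𝔤 such that [e,f] = h, [h,e] = 2e and [h,f] = −2f. -/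
lemma jm_C_nil {V : Type*} [AddCommGroup V] [Module ℂ V] (A B C : Module.End ℂ V)
    (hC : A * B = B * A + C) (hAC : A * C = C * A) :
    ∀ n : ℕ, ∀ j : ℕ, A ^ n * C ^ j = 0 → ∃ k, C ^ k = 0 := by
  have hcomm : Commute A C := hAC
  have key : ∀ p : ℕ, A ^ (p + 1) * B = B * A ^ (p + 1) + ((p : ℂ) + 1) • (A ^ p * C) := by
    intro p
    induction p with
    | zero => simp [hC]
    | succ p ih =>
      rw [pow_succ' A (p + 1), mul_assoc, ih, mul_add, ← mul_assoc, hC, mul_smul_comm,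
        ← mul_assoc A, ← pow_succ', add_mul, mul_assoc B, ← pow_succ',
        ← (hcomm.pow_left (p + 1)).eq]
      push_cast
      module
  intro n
  induction n with
  | zero => intro j h; exact ⟨j, by simpa using h⟩
  | succ n ih =>
    intro j h
    apply ih (j + 1 + j)
    have h2 : C ^ j * A ^ (n + 1) = 0 := by
      rw [← h]; exact (hcomm.pow_pow (n + 1) j).eq.symm
    have h3 : C ^ j * (A ^ (n + 1) * B) * C ^ j = 0 := by
      rw [← mul_assoc, h2]; simp
    rw [key, mul_add, add_mul, mul_assoc, mul_assoc B, h, mul_smul_comm, smul_mul_assoc] at h3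
    have h4 : C ^ j * (A ^ n * C) * C ^ j = A ^ n * C ^ (j + 1 + j) := by
      rw [← mul_assoc, (hcomm.pow_pow n j).eq.symm, mul_assoc (A ^ n), mul_assoc (A ^ n),
        ← pow_succ, ← pow_add]
    rw [h4] at h3
    have h5 : ((n : ℂ) + 1) ≠ 0 := Nat.cast_add_one_ne_zero n
    simpa [h5] using h3

lemma jm_AB_nil {V : Type*} [AddCommGroup V] [Module ℂ V] (A B C : Module.End ℂ V)
    (hC : A * B = B * A + C) (hAC : A * C = C * A) (hA : IsNilpotent A) :
    IsNilpotent (A * B) := by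
  obtain ⟨n, hn⟩ := hA
  obtain ⟨k, hk⟩ := jm_C_nil A B C hC hAC n 0 (by simp [hn])
  have key : ∀ p : ℕ, A ^ p * (A * B) = (A * B + (p : ℂ) • C) * A ^ p := by
    intro p
    induction p with
    | zero => simp
    | succ p ih =>
      have e1 : A * (A * B) = (A * B + C) * A := by
        conv_lhs => rw [hC]
        rw [mul_add, add_mul, hAC, mul_assoc]
      rw [pow_succ' A p, mul_assoc, ih, ← mul_assoc, mul_add, e1, mul_smul_comm, hAC,
        ← mul_assoc]
      push_cast
      rw [← smul_mul_assoc, ← add_mul]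
      congr 2
      module
  have key2 : ∀ p : ℕ, ∀ v, (A ^ (p + 1)) v = 0 → ∀ m : ℕ,
      (A ^ (p + 1)) (((A * B) ^ m) v) = 0 ∧
      (A ^ p) (((A * B) ^ m) v) = ((p : ℂ) + 1) ^ m • (C ^ m) ((A ^ p) v) := by
    intro p v hv m
    induction m with
    | zero => simpa using hv
    | succ m ih =>
      obtain ⟨h1, h2⟩ := ih
      set w := ((A * B) ^ m) v with hw
      have hw' : ((A * B) ^ (m + 1)) v = (A * B) w := by
        rw [pow_succ', Module.End.mul_apply]
      rw [hw']
      constructor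
      · have := LinearMap.congr_fun (key (p + 1)) w
        rw [Module.End.mul_apply, Module.End.mul_apply _ (A ^ (p + 1)), h1, map_zero] at this
        exact this
      · have := LinearMap.congr_fun (key p) w
        have h3 : (A * B) ((A ^ p) w) = C ((A ^ p) w) := by
          rw [hC, LinearMap.add_apply, Module.End.mul_apply B A,
            ← Module.End.mul_apply A (A ^ p), ← pow_succ', h1, map_zero, zero_add]
        rw [Module.End.mul_apply, Module.End.mul_apply _ (A ^ p), LinearMap.add_apply, h3,
          LinearMap.smul_apply, h2, map_smul] at this
        rw [this, pow_succ' C, Module.End.mul_apply]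
        module
  have fin : ∀ p : ℕ, ∀ v, (A ^ p) v = 0 → ((A * B) ^ (k * p)) v = 0 := by
    intro p
    induction p with
    | zero => intro v hv; simpa using hv
    | succ p ih =>
      intro v hv
      rw [mul_add, mul_one, pow_add, Module.End.mul_apply]
      apply ih
      rw [(key2 p v hv k).2, hk]
      simp
  refine ⟨k * n, LinearMap.ext fun v => ?_⟩
  exact fin n v (by simp [hn])

/-- Morozov's lemma, injectivity part. -/
lemma jm_inj {V : Type*} [AddCommGroup V] [Module ℂ V] (E F H : Module.End ℂ V)
    (hEF : E * F = F * E + H) (hHE : E * H = H * E - (2 : ℂ) • E) (hE : IsNilpotent E)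
    (x : V) (hx : E x = 0) (hHx : H x = -((2 : ℂ) • x)) : x = 0 := by
  have hH : ∀ p : ℕ, E ^ p * H = (H - (2 * p : ℂ) • 1) * E ^ p := by
    intro p
    induction p with
    | zero => simp
    | succ p ih =>
      rw [pow_succ', mul_assoc, ih, ← mul_assoc, mul_sub, hHE, ← mul_assoc, mul_smul_comm, mul_one]
      push_cast
      rw [sub_sub, ← add_smul, sub_mul, sub_mul, sub_mul]
      simp only [smul_mul_assoc, one_mul]
      rw [mul_assoc]
      module
  have key : ∀ p : ℕ, E ^ (p + 1) * F =
      F * E ^ (p + 1) + ((p : ℂ) + 1) • ((H - (p : ℂ) • 1) * E ^ p) := by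
    intro p
    induction p with
    | zero => simp [hEF]
    | succ p ih =>
      rw [pow_succ E (p + 1), mul_assoc, hEF, mul_add, ← mul_assoc, ih, hH, add_mul, mul_assoc F,
        smul_mul_assoc, mul_assoc _ (E ^ p), ← pow_succ]
      push_cast
      simp only [sub_mul, smul_mul_assoc, one_mul, ← pow_succ]
      module
  have ind : ∀ p : ℕ, ∃ y, (E ^ p) y = x := by
    intro p
    induction p with
    | zero => exact ⟨x, by simp⟩
    | succ p ih =>
      obtain ⟨y, hy⟩ := ih
      have h1 := LinearMap.congr_fun (key p) y
      have h0 : (E ^ (p + 1)) y = 0 := by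
        rw [pow_succ', Module.End.mul_apply, hy, hx]
      simp only [Module.End.mul_apply, LinearMap.add_apply, LinearMap.smul_apply,
        LinearMap.sub_apply, Module.End.one_apply, h0, hy, hHx, map_zero, zero_add] at h1
      have hp1 : ((p : ℂ) + 1) ≠ 0 := Nat.cast_add_one_ne_zero p
      have hp2 : ((p : ℂ) + 2) ≠ 0 := by exact_mod_cast (by omega : p + 2 ≠ 0)
      refine ⟨(-(((p : ℂ) + 1) * (p + 2))⁻¹) • F y, ?_⟩
      rw [map_smul, h1, ← neg_smul, ← sub_smul, smul_smul, smul_smul]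
      conv_rhs => rw [← one_smul ℂ x]
      congr 1
      field_simp
      ring
  obtain ⟨n, hn⟩ := hE
  obtain ⟨y, hy⟩ := ind n
  rw [← hy, hn]; rfl

/-- **Jacobson–Morozov.** In a finite-dimensional semisimple complex Lie algebra, every
nonzero nilpotent element `e` (i.e. `ad e` is nilpotent) can be included in an
`sl₂`-triple `(e, h, f)`: `⁅e,f⁆ = h`, `⁅h,e⁆ = 2e`, `⁅h,f⁆ = −2f`. -/
theorem jacobson_morozov
    {L : Type*} [LieRing L] [LieAlgebra ℂ L] [FiniteDimensional ℂ L]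
    [LieAlgebra.IsSemisimple ℂ L]
    (e : L) (he : e ≠ 0) (hnil : IsNilpotent (LieAlgebra.ad ℂ L e)) :
    ∃ h f : L, ⁅e, f⁆ = h ∧ ⁅h, e⁆ = (2 : ℂ) • e ∧ ⁅h, f⁆ = -((2 : ℂ) • f) := by
  have hK : LieAlgebra.IsKilling ℂ L := inferInstance
  have hnd := LieAlgebra.IsKilling.killingForm_nondegenerate ℂ L
  have hsymm := LieModule.traceForm_isSymm ℂ L L
  have inv : ∀ x y z : L, killingForm ℂ L ⁅x, y⁆ z = killingForm ℂ L x ⁅y, z⁆ :=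
    fun x y z => LieModule.traceForm_apply_lie_apply ℂ L L x y z
  -- step 1
  have hmem : e ∈ LinearMap.range ((LieAlgebra.ad ℂ L e) ^ 2) := by
    rw [← LinearMap.BilinForm.orthogonal_orthogonal (B := killingForm ℂ L) hnd hsymm.isRefl
      (LinearMap.range ((LieAlgebra.ad ℂ L e) ^ 2))]
    rw [LinearMap.BilinForm.mem_orthogonal_iff]
    intro z hz
    rw [LinearMap.BilinForm.mem_orthogonal_iff] at hz
    have hz2 : ⁅e, ⁅e, z⁆⁆ = 0 := by
      apply hnd.2
      intro y
      have := hz _ ⟨y, rfl⟩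
      simp only [pow_two, Module.End.mul_apply, LieAlgebra.ad_apply] at this
      rw [← lie_skew, LinearMap.map_neg, LinearMap.neg_apply, inv, ← lie_skew, LinearMap.map_neg,
        LinearMap.neg_apply, inv, neg_neg] at this
      exact this
    rw [LieModule.traceForm_comm, killingForm_apply_apply]
    apply IsNilpotent.eq_zero
    apply LinearMap.isNilpotent_trace_of_isNilpotent
    refine jm_AB_nil (LieAlgebra.ad ℂ L e) (LieAlgebra.ad ℂ L z) (LieAlgebra.ad ℂ L ⁅e, z⁆) ?_ ?_ hnil
    · ext v; simp
    · ext v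
      have := leibniz_lie e ⁅e, z⁆ v
      rw [hz2, zero_lie, zero_add] at this
      simpa using this
  obtain ⟨f1, hf1⟩ := hmem
  simp only [pow_two, Module.End.mul_apply, LieAlgebra.ad_apply] at hf1
  obtain ⟨f0, hf0⟩ : ∃ f0, f0 = (-2 : ℂ) • f1 := ⟨_, rfl⟩
  obtain ⟨h, hh⟩ : ∃ h, h = ⁅e, f0⁆ := ⟨_, rfl⟩
  have heh : ⁅e, h⁆ = -((2 : ℂ) • e) := by
    rw [hh, hf0, lie_smul, lie_smul, hf1, neg_smul]
  have hhe : ⁅h, e⁆ = (2 : ℂ) • e := by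
    rw [← lie_skew, heh, neg_neg]
  let T : Module.End ℂ L := LieAlgebra.ad ℂ L h + (2 : ℂ) • 1
  have hT : ∀ x, T x = ⁅h, x⁆ + (2 : ℂ) • x := fun x => by simp [T]
  let N := LinearMap.ker (LieAlgebra.ad ℂ L e)
  have hN : ∀ x, x ∈ N ↔ ⁅e, x⁆ = 0 := fun x => by simp [N]
  have hTN : ∀ x ∈ N, T x ∈ N := by
    intro x hx
    rw [hN] at hx ⊢
    rw [hT, lie_add, leibniz_lie, heh, lie_smul, hx]
    simp [hx]
  have hinj : Function.Injective (T.restrict hTN) := by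
    rw [injective_iff_map_eq_zero]
    rintro ⟨x, hx⟩ hx0
    have hx1 : T x = 0 := congrArg Subtype.val hx0
    rw [hN] at hx
    rw [hT] at hx1
    have : x = 0 := by
      refine jm_inj (LieAlgebra.ad ℂ L e) (LieAlgebra.ad ℂ L f0) (LieAlgebra.ad ℂ L h) ?_ ?_ hnil
        x hx (eq_neg_of_add_eq_zero_left hx1)
      · ext v; simp [hh]
      · ext v
        have := leibniz_lie e h v
        rw [heh] at this
        simp [this]
        abel
    exact Subtype.ext this
  have hsurj := LinearMap.injective_iff_surjective.mp hinj
  have hg : T f0 ∈ N := by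
    rw [hN, hT, lie_add, leibniz_lie, heh, lie_smul, ← hh]
    simp [← hh]
  obtain ⟨⟨g, hgN⟩, hg2⟩ := hsurj ⟨T f0, hg⟩
  have hg3 : T g = T f0 := congrArg Subtype.val hg2
  rw [hN] at hgN
  refine ⟨h, f0 - g, ?_, hhe, ?_⟩
  · rw [lie_sub, hgN, hh, sub_zero]
  · apply eq_neg_of_add_eq_zero_left
    rw [← hT, map_sub, hg3, sub_self]
end

section
/- Let 𝔤 be a finite-dimensional semisimple Lie algebra over ℂ and (e,h,f) an sl₂-triple in 𝔤. Define a bilinear form on 𝔤_{−1} by ⟨x,y⟩ := κ([x,y], e). Then this form is skew-symmetric (⟨x,y⟩ = −⟨y,x⟩ for all x,y ∈ 𝔤_{−1}) and nondegenerate (if x ∈ 𝔤_{−1} satisfies ⟨x,y⟩ = 0 for all y ∈ 𝔤_{−1}, then x = 0). -/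
open Module in
theorem aux_nilp {V : Type*} [AddCommGroup V] [Module ℂ V] [FiniteDimensional ℂ V]
    (H X : End ℂ V) (c : ℂ) (hc : c ≠ 0) (hX : H * X = X * H + c • X) : ∃ k : ℕ, X ^ k = 0 := by
  by_contra! contra
  have hpow : ∀ k : ℕ, H * X ^ k = X ^ k * H + (c * k) • X ^ k := by
    intro k
    induction k with
    | zero => simp
    | succ k ih =>
      rw [pow_succ, ← mul_assoc, ih, add_mul, mul_assoc, hX, mul_add, smul_mul_assoc,
        mul_smul_comm, ← mul_assoc, add_assoc, ← add_smul]
      congr 2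
      push_cast; ring
  let T : End ℂ (End ℂ V) := LinearMap.mulLeft ℂ H - LinearMap.mulRight ℂ H
  have hinj : Function.Injective (fun k : ℕ => c * (k : ℂ)) := fun a b hab => by
    simpa [hc] using hab
  have hli := Module.End.eigenvectors_linearIndependent' T (fun k : ℕ => c * (k : ℂ)) hinj
    (fun k => X ^ k) (fun k => ⟨by
      rw [Module.End.mem_genEigenspace_one]
      simp [T, hpow k], contra k⟩)
  have := hli.finite
  exact not_finite ℕ

section
open Module LieAlgebra

variable {L : Type*} [LieRing L] [LieAlgebra ℂ L] [FiniteDimensional ℂ L] {h e f : L}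

theorem aux_EH (t : IsSl2Triple h e f) : ad ℂ L h * ad ℂ L e = ad ℂ L e * ad ℂ L h + (2:ℂ) • ad ℂ L e := by
  ext x
  have := leibniz_lie h e x
  rw [t.lie_h_e_smul ℂ] at this
  simp [this, add_comm]

theorem aux_FH (t : IsSl2Triple h e f) : ad ℂ L h * ad ℂ L f = ad ℂ L f * ad ℂ L h + (-2:ℂ) • ad ℂ L f := by
  ext x
  have := leibniz_lie h f x
  rw [t.lie_lie_smul_f ℂ] at this
  simp [this, add_comm]

theorem aux_EF (t : IsSl2Triple h e f) : ad ℂ L e * ad ℂ L f = ad ℂ L f * ad ℂ L e + ad ℂ L h := by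
  ext x
  have := leibniz_lie e f x
  rw [t.lie_e_f] at this
  simp [this, add_comm]

theorem aux_HFk (t : IsSl2Triple h e f) (k : ℕ) : ad ℂ L h * ad ℂ L f ^ k =
    ad ℂ L f ^ k * ad ℂ L h - (2 * k : ℂ) • ad ℂ L f ^ k := by
  induction k with
  | zero => simp
  | succ k ih =>
    rw [pow_succ, ← mul_assoc, ih, sub_mul, mul_assoc, aux_FH t, mul_add]
    simp only [smul_mul_assoc, mul_smul_comm, ← mul_assoc]
    push_cast
    module

theorem aux_HEk (t : IsSl2Triple h e f) (k : ℕ) : ad ℂ L h * ad ℂ L e ^ k =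
    ad ℂ L e ^ k * ad ℂ L h + (2 * k : ℂ) • ad ℂ L e ^ k := by
  induction k with
  | zero => simp
  | succ k ih =>
    rw [pow_succ, ← mul_assoc, ih, add_mul, mul_assoc, aux_EH t, mul_add]
    simp only [smul_mul_assoc, mul_smul_comm, ← mul_assoc]
    push_cast
    module

theorem aux_EFk (t : IsSl2Triple h e f) (k : ℕ) : ad ℂ L e * ad ℂ L f ^ (k+1) =
    ad ℂ L f ^ (k+1) * ad ℂ L e +
      (k + 1 : ℂ) • (ad ℂ L f ^ k * ad ℂ L h) - ((k + 1) * k : ℂ) • ad ℂ L f ^ k := by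
  induction k with
  | zero => simp [aux_EF t]
  | succ k ih =>
    rw [pow_succ, ← mul_assoc, ih, sub_mul, add_mul, mul_assoc, aux_EF t, mul_add]
    simp only [smul_mul_assoc, mul_smul_comm, mul_assoc, aux_FH t, mul_add]
    simp only [← mul_assoc, ← pow_succ]
    push_cast
    module

/-- primitive generalized weight vectors are genuine weight vectors -/
theorem aux_prim (t : IsSl2Triple h e f) (μ : ℂ) (w u : L) (hw : ⁅e, w⁆ = 0)
    (hu : ⁅h, w⁆ = μ • w + u) (hu2 : ⁅h, u⁆ = μ • u) : u = 0 := by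
  by_contra hu0
  have heu : ⁅e, u⁆ = 0 := by
    have h1 := leibniz_lie h e w
    rw [hw, t.lie_h_e_smul ℂ, smul_lie, hw, hu, lie_add, lie_smul, hw] at h1
    simpa using h1.symm
  have P : t.HasPrimitiveVectorWith u μ := ⟨hu0, hu2, heu⟩
  obtain ⟨n, hn⟩ := P.exists_nat
  have hne : ∀ i ≤ n, (ad ℂ L f ^ i) u ≠ 0 := fun i hi => P.pow_toEnd_f_ne_zero_of_eq_nat hn hi
  have hze : (ad ℂ L f ^ (n+1)) u = 0 := P.pow_toEnd_f_eq_zero_of_eq_nat hn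
  have hJ : ∃ k : ℕ, (ad ℂ L f ^ k) w = 0 := by
    obtain ⟨k, hk⟩ := aux_nilp (ad ℂ L h) (ad ℂ L f) (-2) (by norm_num) (aux_FH t)
    exact ⟨k, by simp [hk]⟩
  have hw0 : ¬ w = 0 := by
    rintro rfl
    apply hu0
    simpa using hu.symm
  obtain ⟨j, hj1, hj2⟩ := Nat.exists_not_and_succ_of_not_zero_of_exists
    (p := fun k => (ad ℂ L f ^ k) w = 0) (by simpa using hw0) hJ
  have hju : (ad ℂ L f ^ (j+1)) u = 0 := by
    have := LinearMap.congr_fun (aux_HFk t (j+1)) w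
    simp only [Module.End.mul_apply, LinearMap.sub_apply, LinearMap.smul_apply, hj2, ad_apply, hu,
      map_add, map_smul] at this
    simpa using this.symm
  have key := LinearMap.congr_fun (aux_EFk t j) w
  simp only [Module.End.mul_apply, LinearMap.sub_apply, LinearMap.smul_apply, LinearMap.add_apply,
    hj2, ad_apply, hu, hw, map_add, map_smul, lie_zero, map_zero, zero_add] at key
  have hnj : n ≤ j := by
    by_contra hlt
    exact hne (j+1) (by omega) hju
  have hj0 : (j + 1 : ℂ) ≠ 0 := Nat.cast_add_one_ne_zero j
  have key2 : (μ - j) • (ad ℂ L f ^ j) w + (ad ℂ L f ^ j) u = 0 := by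
    have : (j + 1 : ℂ) • ((μ - j) • (ad ℂ L f ^ j) w + (ad ℂ L f ^ j) u) = 0 := by
      rw [key]; module
    exact (smul_eq_zero.mp this).resolve_left hj0
  rcases hnj.eq_or_lt with rfl | hlt
  · rw [hn, sub_self, zero_smul, zero_add] at key2
    exact hne n le_rfl key2
  · have : (ad ℂ L f ^ j) u = 0 := by
      obtain ⟨d, rfl⟩ := Nat.exists_eq_add_of_lt hlt
      rw [show n + d + 1 = d + (n+1) by ring, pow_add, Module.End.mul_apply, hze, map_zero]
    rw [this, add_zero, hn] at key2
    rcases smul_eq_zero.mp key2 with h0 | h0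
    · rw [sub_eq_zero] at h0
      have : n = j := by exact_mod_cast h0
      omega
    · exact hj1 h0

theorem aux_casE (t : IsSl2Triple h e f) :
    Commute ((4:ℂ) • (ad ℂ L f * ad ℂ L e) + ad ℂ L h * ad ℂ L h + (2:ℂ) • ad ℂ L h) (ad ℂ L e) := by
  have hEF := aux_EF t
  have hEH := aux_EH t
  have h2 : ad ℂ L e * ad ℂ L h = ad ℂ L h * ad ℂ L e - (2:ℂ) • ad ℂ L e := by rw [hEH]; module
  generalize ad ℂ L e = E at *
  generalize ad ℂ L f = F at *
  generalize ad ℂ L h = H at *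
  unfold Commute SemiconjBy
  have h3 : E * (H * H) = H * (H * E) - (4:ℂ) • (H * E) + (4:ℂ) • E := by
    rw [← mul_assoc, h2, sub_mul, mul_assoc, h2, mul_sub, smul_mul_assoc, h2, mul_smul_comm]
    module
  rw [mul_add, mul_add, mul_smul_comm, mul_smul_comm, h3, h2, ← mul_assoc, hEF, add_mul, add_mul,
    add_mul, smul_mul_assoc, smul_mul_assoc]
  simp only [mul_assoc]
  module

theorem aux_casH (t : IsSl2Triple h e f) :
    Commute ((4:ℂ) • (ad ℂ L f * ad ℂ L e) + ad ℂ L h * ad ℂ L h + (2:ℂ) • ad ℂ L h) (ad ℂ L h) := by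
  have hFH := aux_FH t
  have hEH := aux_EH t
  generalize ad ℂ L e = E at *
  generalize ad ℂ L f = F at *
  generalize ad ℂ L h = H at *
  unfold Commute SemiconjBy
  have h3 : H * (F * E) = F * E * H := by
    rw [← mul_assoc, hFH, add_mul, mul_assoc, hEH, mul_add, smul_mul_assoc, mul_smul_comm,
      ← mul_assoc]
    module
  rw [mul_add, mul_add, mul_smul_comm, mul_smul_comm, h3, add_mul, add_mul, smul_mul_assoc,
    smul_mul_assoc, mul_assoc H H H]

theorem aux_ss_cas (t : IsSl2Triple h e f) (c : ℂ) (v u : L)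
    (hv : v ∈ End.maxGenEigenspace
      ((4:ℂ) • (ad ℂ L f * ad ℂ L e) + ad ℂ L h * ad ℂ L h + (2:ℂ) • ad ℂ L h) c)
    (hu : ⁅h, v⁆ = -v + u) (hu2 : ⁅h, u⁆ = -u) : u = 0 := by
  have hcE := aux_casE t
  have hcH := aux_casH t
  have hCdef : ∀ x, ((4:ℂ) • (ad ℂ L f * ad ℂ L e) + ad ℂ L h * ad ℂ L h + (2:ℂ) • ad ℂ L h) x =
    (4:ℂ) • ⁅f, ⁅e, x⁆⁆ + ⁅h, ⁅h, x⁆⁆ + (2:ℂ) • ⁅h, x⁆ := fun x => by simp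
  generalize (4:ℂ) • (ad ℂ L f * ad ℂ L e) + ad ℂ L h * ad ℂ L h + (2:ℂ) • ad ℂ L h = C at *
  have hstab : ∀ (g : End ℂ L), Commute C g → ∀ x ∈ End.maxGenEigenspace C c,
      g x ∈ End.maxGenEigenspace C c := fun g hg x hx =>
    End.mapsTo_maxGenEigenspace_of_comm hg c hx
  -- weights of primitive vectors
  have hprim : ∀ (w : L) (μ : ℂ), w ∈ End.maxGenEigenspace C c → w ≠ 0 → ⁅e, w⁆ = 0 →
      ⁅h, w⁆ = μ • w → c = μ * μ + 2 * μ := by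
    intro w μ hw hw0 hew hhw
    have hCw : C w = (μ * μ + 2 * μ) • w := by
      rw [hCdef, hew, hhw, lie_smul, hhw, lie_zero]; module
    by_contra hne
    have hd := Module.End.disjoint_genEigenspace C hne ⊤ 1
    refine hw0 ((Submodule.disjoint_def.mp hd) w hw ?_)
    rw [Module.End.mem_genEigenspace_one]
    exact hCw
  obtain ⟨k, hk⟩ := aux_nilp (ad ℂ L h) (ad ℂ L e) 2 (by norm_num) (aux_EH t)
  -- for `w` in weight spaces
  have hw1 : ∀ j : ℕ, ⁅h, (ad ℂ L e ^ j) v⁆ = (-1 + 2 * j : ℂ) • (ad ℂ L e ^ j) v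
      + (ad ℂ L e ^ j) u := by
    intro j
    have := LinearMap.congr_fun (aux_HEk t j) v
    simp only [Module.End.mul_apply, LinearMap.smul_apply, LinearMap.add_apply, ad_apply, hu,
      map_add, map_neg] at this
    rw [this]; module
  have hw2 : ∀ j : ℕ, ⁅h, (ad ℂ L e ^ j) u⁆ = (-1 + 2 * j : ℂ) • (ad ℂ L e ^ j) u := by
    intro j
    have := LinearMap.congr_fun (aux_HEk t j) u
    simp only [Module.End.mul_apply, LinearMap.smul_apply, LinearMap.add_apply, ad_apply, hu2,
      map_neg] at this
    rw [this]; module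
  have hmu : u ∈ End.maxGenEigenspace C c := by
    have : u = (ad ℂ L h) v + v := by rw [ad_apply, hu]; abel
    rw [this]
    exact add_mem (hstab _ hcH v hv) hv
  by_contra hu0
  have hv0 : ¬ v = 0 := by
    rintro rfl
    apply hu0
    simpa using hu.symm
  obtain ⟨i, hi1, hi2⟩ := Nat.exists_not_and_succ_of_not_zero_of_exists
    (p := fun k => (ad ℂ L e ^ k) u = 0) (by simpa using hu0) ⟨k, by simp [hk]⟩
  obtain ⟨j, hj1, hj2⟩ := Nat.exists_not_and_succ_of_not_zero_of_exists
    (p := fun k => (ad ℂ L e ^ k) v = 0) (by simpa using hv0) ⟨k, by simp [hk]⟩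
  have hei : ⁅e, (ad ℂ L e ^ i) u⁆ = 0 := by
    rw [pow_succ', Module.End.mul_apply] at hi2; exact hi2
  have hej : ⁅e, (ad ℂ L e ^ j) v⁆ = 0 := by
    rw [pow_succ', Module.End.mul_apply] at hj2; exact hj2
  have hju := aux_prim t _ _ _ hej (hw1 j) (hw2 j)
  have hjv := hw1 j
  rw [hju, add_zero] at hjv
  have c1 := hprim _ _ (hstab _ (hcE.pow_right i) _ hmu) hi1 hei (hw2 i)
  have c2 := hprim _ _ (hstab _ (hcE.pow_right j) _ hv) hj1 hej hjv
  have hij : i = j := by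
    have : (i : ℂ) ^ 2 = (j : ℂ) ^ 2 := by linear_combination (c2 - c1) / 4
    have h3 : i ^ 2 = j ^ 2 := by exact_mod_cast this
    exact Nat.pow_left_injective (n := 2) (by norm_num) h3
  subst hij
  exact hi1 hju

theorem aux_ss (t : IsSl2Triple h e f) (v : L)
    (hv : (ad ℂ L h + 1) ((ad ℂ L h + 1) v) = 0) : (ad ℂ L h + 1) v = 0 := by
  have hcH := aux_casH t
  have hss := aux_ss_cas t
  generalize (4:ℂ) • (ad ℂ L f * ad ℂ L e) + ad ℂ L h * ad ℂ L h + (2:ℂ) • ad ℂ L h = C at *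
  let D : End ℂ L := ad ℂ L h + 1
  have hcD : Commute C (D * D) := by
    have : Commute C D := hcH.add_right (Commute.one_right C)
    exact this.mul_right this
  have hst : ∀ x ∈ LinearMap.ker (D * D), C x ∈ LinearMap.ker (D * D) := by
    intro x hx
    rw [LinearMap.mem_ker] at hx ⊢
    rw [← Module.End.mul_apply, ← hcD.eq, Module.End.mul_apply, hx, map_zero]
  have hdec := Submodule.inf_iSup_genEigenspace (p := LinearMap.ker (D * D)) (f := C) hst (k := ⊤)
  have hmem : v ∈ LinearMap.ker (D * D) ⊓ ⨆ μ, C.genEigenspace μ ⊤ := by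
    refine ⟨hv, ?_⟩
    have := Module.End.iSup_maxGenEigenspace_eq_top C
    unfold Module.End.maxGenEigenspace at this
    rw [this]; trivial
  rw [hdec] at hmem
  have hle : (⨆ μ, LinearMap.ker (D * D) ⊓ C.genEigenspace μ ⊤) ≤ LinearMap.ker D := by
    refine iSup_le fun c x hx => ?_
    have hx1 : D (D x) = 0 := hx.1
    refine hss c x (D x) hx.2 ?_ ?_
    · simp [D]
    · have : D (D x) = ⁅h, D x⁆ + D x := by simp [D]
      rw [this] at hx1
      exact eq_neg_of_add_eq_zero_left hx1
  exact hle hmem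

end

/-- For an `sl₂`-triple `(e,h,f)` in a finite-dimensional semisimple complex Lie algebra,
the form `⟨x,y⟩ = κ(⁅x,y⁆, e)` on the Dynkin piece `𝔤_{−1}` is skew-symmetric and
nondegenerate. -/
theorem skew_form_on_minus_one_piece
    {L : Type*} [LieRing L] [LieAlgebra ℂ L] [FiniteDimensional ℂ L]
    [LieAlgebra.IsSemisimple ℂ L]
    (e h f : L) (he : e ≠ 0) (hh : h ≠ 0) (hf : f ≠ 0)
    (hhe : ⁅h, e⁆ = (2 : ℂ) • e) (hhf : ⁅h, f⁆ = -((2 : ℂ) • f)) (hef : ⁅e, f⁆ = h) :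
    (∀ x ∈ Module.End.eigenspace (LieAlgebra.ad ℂ L h) ((-1 : ℤ) : ℂ),
       ∀ y ∈ Module.End.eigenspace (LieAlgebra.ad ℂ L h) ((-1 : ℤ) : ℂ),
         killingForm ℂ L ⁅x, y⁆ e = -killingForm ℂ L ⁅y, x⁆ e) ∧
    (∀ x ∈ Module.End.eigenspace (LieAlgebra.ad ℂ L h) ((-1 : ℤ) : ℂ),
       (∀ y ∈ Module.End.eigenspace (LieAlgebra.ad ℂ L h) ((-1 : ℤ) : ℂ),
          killingForm ℂ L ⁅x, y⁆ e = 0) → x = 0) := by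
  have t : IsSl2Triple h e f := ⟨hh, hef, by rw [hhe, ofNat_smul_eq_nsmul], by
    rw [hhf, ofNat_smul_eq_nsmul]⟩
  refine ⟨fun x _ y _ => ?_, fun x hx hxy => ?_⟩
  · rw [← lie_skew x y, map_neg, LinearMap.neg_apply]
  have hmem : ∀ y, y ∈ Module.End.eigenspace (LieAlgebra.ad ℂ L h) ((-1 : ℤ) : ℂ) ↔
      ⁅h, y⁆ = -y := by
    intro y
    rw [Module.End.mem_eigenspace_iff]
    simp
  rw [hmem] at hx
  set z : L := ⁅e, x⁆ with hz
  have hhz : ⁅h, z⁆ = z := by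
    rw [hz, leibniz_lie, hhe, hx, smul_lie, lie_neg]; module
  have hzy : ∀ y, ⁅h, y⁆ = -y → killingForm ℂ L y z = 0 := by
    intro y hy
    have h1 := hxy y ((hmem y).2 hy)
    rw [← lie_skew, map_neg, LinearMap.neg_apply, neg_eq_zero,
      LieModule.traceForm_apply_lie_apply, ← lie_skew, map_neg, neg_eq_zero] at h1
    exact h1
  let D : Module.End ℂ L := LieAlgebra.ad ℂ L h + 1
  have hdis : Disjoint (LinearMap.ker D) (LinearMap.range D) := by
    rw [Submodule.disjoint_def]
    rintro _ h1 ⟨b, rfl⟩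
    exact aux_ss t b h1
  have htop : LinearMap.ker D ⊔ LinearMap.range D = ⊤ := by
    apply Submodule.eq_top_of_disjoint _ _ _ hdis
    rw [add_comm]
    exact (LinearMap.finrank_range_add_finrank_ker D).ge
  have hz0 : z = 0 := by
    have : z ∈ LieIdeal.killingCompl ℂ L ⊤ := by
      rw [LieIdeal.mem_killingCompl]
      intro y _
      have hy : y ∈ LinearMap.ker D ⊔ LinearMap.range D := htop ▸ Submodule.mem_top
      obtain ⟨a, ha, _, ⟨b, rfl⟩, rfl⟩ := Submodule.mem_sup.1 hy
      have ha' : ⁅h, a⁆ + a = 0 := by simpa [D] using ha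
      have hb : D b = ⁅h, b⁆ + b := by simp [D]
      rw [map_add, LinearMap.add_apply, hzy a (eq_neg_of_add_eq_zero_left ha'), hb, map_add,
        LinearMap.add_apply, LieModule.traceForm_apply_lie_apply', hhz]
      simp
    simpa using this
  by_contra hx0
  have P : t.HasPrimitiveVectorWith x (-1 : ℂ) := ⟨hx0, by rw [hx]; simp, hz0⟩
  obtain ⟨n, hn⟩ := P.exists_nat
  have : ((n + 1 : ℕ) : ℂ) = 0 := by push_cast; rw [← hn]; ring
  exact Nat.cast_ne_zero.mpr (Nat.succ_ne_zero n) this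
end

section
/- Let 𝔤 be a finite-dimensional semisimple Lie algebra over ℂ, (e,h,f) an sl₂-triple in 𝔤, and χ : 𝔤 → ℂ the linear form χ(x) = κ(x,e). Let 𝔩 ⊆ 𝔤_{−1} be a Lagrangian subspace for the skew form ⟨x,y⟩ = κ([x,y],e) (i.e. ⟨x,y⟩ = 0 for all x,y ∈ 𝔩, and dim 𝔩 = ½ dim 𝔤_{−1}), and set 𝔪 = 𝔩 ⊕ ⊕_{j ≤ −2} 𝔤_j. Then 𝔪 is a Lie subalgebra of 𝔤, and χ vanishes on brackets of elements of 𝔪: χ([a,b]) = 0 for all a, b ∈ 𝔪; in other words, the restriction χ|_𝔪 is a one-dimensional representation of 𝔪. -/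
/-- For an `sl₂`-triple `(e,h,f)` in a finite-dimensional semisimple complex Lie algebra,
let `𝔩 ⊆ 𝔤_{−1}` be a Lagrangian subspace for the skew form `⟨x,y⟩ = κ(⁅x,y⁆,e)` and set
`𝔪 = 𝔩 ⊕ ⊕_{j ≤ −2} 𝔤_j`.  Then `𝔪` is a Lie subalgebra of `𝔤` and `χ(x) = κ(x,e)`
vanishes on brackets of elements of `𝔪`, i.e. `χ|_𝔪` is a one-dimensional representation. -/
theorem m_subalgebra_chi_one_dimensional_rep
    {L : Type*} [LieRing L] [LieAlgebra ℂ L] [FiniteDimensional ℂ L]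
    [LieAlgebra.IsSemisimple ℂ L]
    (e h f : L) (he : e ≠ 0) (hh : h ≠ 0) (hf : f ≠ 0)
    (hhe : ⁅h, e⁆ = (2 : ℂ) • e) (hhf : ⁅h, f⁆ = -((2 : ℂ) • f)) (hef : ⁅e, f⁆ = h)
    (l : Submodule ℂ L)
    (hl : l ≤ Module.End.eigenspace (LieAlgebra.ad ℂ L h) ((-1 : ℤ) : ℂ))
    (hlIso : ∀ x ∈ l, ∀ y ∈ l, killingForm ℂ L ⁅x, y⁆ e = 0)
    (hlDim : 2 * Module.finrank ℂ l
      = Module.finrank ℂ (Module.End.eigenspace (LieAlgebra.ad ℂ L h) ((-1 : ℤ) : ℂ)))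
    (m : Submodule ℂ L)
    (hm : m = l ⊔ ⨆ j : ℕ,
      Module.End.eigenspace (LieAlgebra.ad ℂ L h) ((-(j : ℤ) - 2 : ℤ) : ℂ)) :
    (∀ a ∈ m, ∀ b ∈ m, ⁅a, b⁆ ∈ m) ∧
    (∀ a ∈ m, ∀ b ∈ m, killingForm ℂ L ⁅a, b⁆ e = 0) := by
  have eig : ∀ (c : ℂ) (x : L), x ∈ Module.End.eigenspace (LieAlgebra.ad ℂ L h) c ↔ ⁅h, x⁆ = c • x := by
    intro c x
    rw [Module.End.mem_eigenspace_iff, LieAlgebra.ad_apply]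
  have chi : ∀ (c : ℂ) (x : L), c ≠ -2 → ⁅h, x⁆ = c • x → killingForm ℂ L x e = 0 := by
    intro c x hc hx
    have h1 : killingForm ℂ L ⁅x, h⁆ e = killingForm ℂ L x ⁅h, e⁆ :=
      LieModule.traceForm_apply_lie_apply ℂ L L x h e
    rw [← lie_skew, hx, hhe] at h1
    simp only [map_neg, map_smul, LinearMap.neg_apply, LinearMap.smul_apply, smul_eq_mul] at h1
    have h2 : (c + 2) * killingForm ℂ L x e = 0 := by linear_combination -h1
    rcases mul_eq_zero.mp h2 with h3 | h3
    · exact absurd (eq_neg_of_add_eq_zero_left h3) hc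
    · exact h3
  have br : ∀ (c d : ℂ) (x y : L), ⁅h, x⁆ = c • x → ⁅h, y⁆ = d • y →
      ⁅h, ⁅x, y⁆⁆ = (c + d) • ⁅x, y⁆ := by
    intro c d x y hx hy
    rw [leibniz_lie, hx, hy, smul_lie, lie_smul, add_smul]
  have low : ∀ (j : ℕ) (x : L), ⁅h, x⁆ = (-(j : ℂ) - 2) • x → x ∈ m := by
    intro j x hx
    rw [hm]
    refine Submodule.mem_sup_right (Submodule.mem_iSup_of_mem j ?_)
    rw [eig, hx]
    push_cast
    rfl
  let N : Submodule ℂ L := m ⊓ LinearMap.ker ((killingForm ℂ L).flip e)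
  have memN : ∀ x, x ∈ N ↔ x ∈ m ∧ killingForm ℂ L x e = 0 := by
    intro x
    simp [N]
  have lowN : ∀ (j : ℕ) (x : L), ⁅h, x⁆ = (-((j + 1 : ℕ) : ℂ) - 2) • x → x ∈ N := by
    intro j x hx
    refine (memN x).2 ⟨low _ x hx, chi _ x ?_ hx⟩
    intro hc
    have : ((j + 1 : ℕ) : ℂ) = 0 := by linear_combination -hc
    exact Nat.succ_ne_zero j (Nat.cast_eq_zero.mp this)
  have hl' : ∀ x ∈ l, ⁅h, x⁆ = (-1 : ℂ) • x := by
    intro x hx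
    have := (eig _ x).1 (hl hx)
    simpa using this
  have key : ∀ P : Submodule ℂ L, (∀ x ∈ l, x ∈ P) →
      (∀ (j : ℕ) (x : L), ⁅h, x⁆ = (-(j : ℂ) - 2) • x → x ∈ P) → m ≤ P := by
    intro P h1 h2
    rw [hm]
    refine sup_le h1 (iSup_le fun j x hx => h2 j x ?_)
    rw [eig] at hx
    rw [hx]
    push_cast
    rfl
  have main : ∀ a ∈ m, ∀ b ∈ m, ⁅a, b⁆ ∈ N := by
    have sw : ∀ a b : L, ⁅a, b⁆ ∈ N → ⁅b, a⁆ ∈ N := by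
      intro a b hab
      rw [← lie_skew]
      exact N.neg_mem hab
    have gen1 : ∀ a ∈ l, ∀ b ∈ m, ⁅a, b⁆ ∈ N := by
      intro a ha
      refine key (N.comap (LieAlgebra.ad ℂ L a)) ?_ ?_
      · intro b hb
        refine (memN _).2 ⟨low 0 _ ?_, hlIso a ha b hb⟩
        rw [LieAlgebra.ad_apply, br _ _ _ _ (hl' a ha) (hl' b hb)]
        norm_num
      · intro j b hb
        refine lowN j _ ?_
        rw [LieAlgebra.ad_apply, br _ _ _ _ (hl' a ha) hb]
        congr 1
        push_cast
        ring
    have gen2 : ∀ (j : ℕ) (a : L), ⁅h, a⁆ = (-(j : ℂ) - 2) • a → ∀ b ∈ m, ⁅a, b⁆ ∈ N := by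
      intro j a ha
      refine key (N.comap (LieAlgebra.ad ℂ L a)) ?_ ?_
      · intro b hb
        exact sw _ _ (gen1 b hb a (low j a ha))
      · intro k b hb
        refine lowN (j + k + 1) _ ?_
        rw [LieAlgebra.ad_apply, br _ _ _ _ ha hb]
        congr 1
        push_cast
        ring
    intro a ha b hb
    refine sw _ _ ?_
    refine key (N.comap (LieAlgebra.ad ℂ L b)) ?_ ?_ ha
    · intro x hx
      exact sw _ _ (gen1 x hx b hb)
    · intro j x hx
      exact sw _ _ (gen2 j x hx b hb)
  exact ⟨fun a ha b hb => ((memN _).1 (main a ha b hb)).1,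
    fun a ha b hb => ((memN _).1 (main a ha b hb)).2⟩
end

section
/- Let 𝔤 be a finite-dimensional semisimple Lie algebra over ℂ and (e,h,f) an sl₂-triple whose Dynkin grading is even, i.e. 𝔤_j = 0 for all odd j. Then the subspace 𝔳 = ⊕_{j ≥ 0} 𝔤_j decomposes as an internal direct sum 𝔳 = 𝔤^e ⊕ ⊕_{j ≥ 2} [f, 𝔤_j], where [f, 𝔤_j] = {[f,x] : x ∈ 𝔤_j}. -/
section aux
variable {V : Type*} [AddCommGroup V] [Module ℂ V] [FiniteDimensional ℂ V]

lemma aux_comm_pow (H A : Module.End ℂ V) (c : ℂ)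
    (hA : ∀ x, H (A x) = A (H x) + c • A x) (n : ℕ) (x : V) :
    H ((A ^ n) x) = (A ^ n) (H x) + ((n : ℂ) * c) • (A ^ n) x := by
  induction n with
  | zero => simp
  | succ n ih =>
    rw [pow_succ', Module.End.mul_apply, Module.End.mul_apply, hA, ih, map_add, map_smul]
    push_cast
    module

lemma aux_nilp_s13 (H A : Module.End ℂ V) (c : ℂ) (hc : c ≠ 0)
    (hA : ∀ x, H (A x) = A (H x) + c • A x) : ∃ n : ℕ, A ^ n = 0 := by
  by_contra! contra
  have hinj : Function.Injective (fun n : ℕ => (n : ℂ) * c) := by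
    intro a b hab
    simpa [hc] using hab
  have := (Module.End.eigenvectors_linearIndependent'
    (LinearMap.mulLeft ℂ H - LinearMap.mulRight ℂ H) (fun n : ℕ => (n : ℂ) * c) hinj
    (fun n => A ^ n) (fun n => by
      refine ⟨?_, contra n⟩
      rw [Module.End.mem_eigenspace_iff]
      ext x
      have := aux_comm_pow H A c hA n x
      simp [this])).finite
  exact not_finite ℕ

variable (E H F : Module.End ℂ V)

lemma aux_inj (hE : ∀ x, H (E x) = E (H x) + (2 : ℂ) • E x)
    (hEF : ∀ x, E (F x) = F (E x) + H x) (j : ℕ) (y : V)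
    (hy : H y = ((j : ℂ) + 2) • y) (h0 : E (F y) = 0) : y = 0 := by
  obtain ⟨n, hn⟩ := aux_nilp_s13 H E 2 two_ne_zero hE
  have key : ∀ i : ℕ, F ((E ^ (i + 1)) y) = (-(((i : ℂ) + 1) * (j + 2 + i))) • (E ^ i) y := by
    intro i
    have h2 := aux_comm_pow H E 2 hE
    induction i with
    | zero =>
      have := hEF y
      rw [h0, hy] at this
      simp only [zero_add, pow_one, pow_zero, Module.End.one_apply]
      rw [eq_neg_of_add_eq_zero_left this.symm]
      push_cast
      module
    | succ i ih =>
      have h3 := hEF ((E ^ (i + 1)) y)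
      rw [ih, h2, hy, map_smul, map_smul, ← Module.End.mul_apply E, ← pow_succ',
        ← Module.End.mul_apply E, ← pow_succ'] at h3
      rw [← sub_eq_iff_eq_add] at h3
      rw [← h3]
      push_cast
      module
  have desc : ∀ n : ℕ, (E ^ n) y = 0 → y = 0 := by
    intro n
    induction n with
    | zero => simp
    | succ n ih =>
      intro h
      apply ih
      have := key n
      rw [h, map_zero, eq_comm, smul_eq_zero] at this
      refine this.resolve_left ?_
      rw [neg_eq_zero]
      norm_cast
      positivity
  exact desc n (by simp [hn])

lemma aux_surj (hE : ∀ x, H (E x) = E (H x) + (2 : ℂ) • E x)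
    (hF : ∀ x, H (F x) = F (H x) - (2 : ℂ) • F x)
    (hEF : ∀ x, E (F x) = F (E x) + H x) (j : ℕ) (y : V)
    (hy : H y = ((j : ℂ) + 2) • y) : ∃ z, H z = ((j : ℂ) + 2) • z ∧ E (F z) = y := by
  let p := Module.End.eigenspace H ((j : ℂ) + 2)
  have hm : ∀ z, z ∈ p ↔ H z = ((j : ℂ) + 2) • z := fun z => Module.End.mem_eigenspace_iff
  have hmap : Set.MapsTo (E * F) p p := by
    intro z hz
    have hz := (hm z).1 hz
    refine (hm _).2 ?_
    rw [Module.End.mul_apply, hE, hF, hz]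
    simp
  have hi : Set.InjOn (E * F) p := by
    intro a ha b hb hab
    have ha := (hm a).1 ha
    have hb := (hm b).1 hb
    refine sub_eq_zero.1 (aux_inj E H F hE hEF j (a - b) ?_ ?_)
    · rw [map_sub, ha, hb, smul_sub]
    · rw [map_sub, map_sub]
      exact sub_eq_zero.2 hab
  have hs := (LinearMap.injOn_iff_surjOn hmap).1 hi
  obtain ⟨z, hz, hzy⟩ := hs ((hm y).2 hy)
  exact ⟨z, (hm z).1 hz, hzy⟩

lemma aux_ker (hE : ∀ x, H (E x) = E (H x) + (2 : ℂ) • E x)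
    (hF : ∀ x, H (F x) = F (H x) - (2 : ℂ) • F x)
    (hEF : ∀ x, E (F x) = F (E x) + H x) (v : V) (hv : E v = 0) :
    v ∈ ⨆ j : ℕ, Module.End.eigenspace H (j : ℂ) := by
  have hF' : ∀ x, H (F x) = F (H x) + (-2 : ℂ) • F x := by
    intro x
    rw [hF]
    module
  obtain ⟨n, hn⟩ := aux_nilp_s13 H F (-2) (by norm_num) hF'
  have h2 := aux_comm_pow H F (-2) hF'
  have key : ∀ (n : ℕ) (v : V), E v = 0 →
      E ((F ^ (n + 1)) v) = ((n : ℂ) + 1) • (F ^ n) (H v - (n : ℂ) • v) := by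
    intro n v hv
    induction n with
    | zero => simp [hEF, hv]
    | succ n ih =>
      rw [pow_succ', Module.End.mul_apply, hEF, ih, map_smul, h2, ← Module.End.mul_apply,
        ← pow_succ']
      simp only [map_sub, map_smul]
      push_cast
      module
  have main : ∀ (n : ℕ) (v : V), E v = 0 → (F ^ n) v = 0 →
      v ∈ ⨆ j : Fin n, Module.End.eigenspace H ((j : ℕ) : ℂ) := by
    intro n
    induction n with
    | zero =>
      intro v _ h
      have : v = 0 := by simpa using h
      rw [this]
      exact zero_mem _
    | succ n ih =>
      intro v hv h
      have h3 := key n v hv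
      rw [h, map_zero, eq_comm, smul_eq_zero] at h3
      have h4 := h3.resolve_left (by norm_cast)
      have h5 := ih (H v - (n : ℂ) • v) (by
        have := hE v
        rw [hv] at this
        simpa [hv] using this.symm) h4
      have h6 : (⨆ j : Fin n, Module.End.eigenspace H ((j : ℕ) : ℂ)) ≤
          Submodule.map (H - (n : ℂ) • 1) (⨆ j : Fin n, Module.End.eigenspace H ((j : ℕ) : ℂ)) := by
        refine iSup_le fun j x hx => ?_
        have hne : ((j : ℕ) : ℂ) - n ≠ 0 := by
          rw [sub_ne_zero]
          exact_mod_cast j.2.ne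
        refine ⟨(((j : ℕ) : ℂ) - n)⁻¹ • x, Submodule.smul_mem _ _
          (Submodule.mem_iSup_of_mem j hx), ?_⟩
        rw [Module.End.mem_eigenspace_iff] at hx
        rw [map_smul, LinearMap.sub_apply, hx, LinearMap.smul_apply, Module.End.one_apply,
          ← sub_smul, smul_smul, inv_mul_cancel₀ hne, one_smul]
      obtain ⟨u, hu, huv⟩ := h6 h5
      have h7 : v - u ∈ Module.End.eigenspace H (n : ℂ) := by
        rw [Module.End.mem_eigenspace_iff, map_sub]
        simp only [LinearMap.sub_apply, LinearMap.smul_apply, Module.End.one_apply] at huv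
        rw [← sub_eq_zero] at huv ⊢
        rw [← neg_eq_zero, ← huv]
        module
      rw [← sub_add_cancel v u]
      refine add_mem (Submodule.mem_iSup_of_mem (Fin.last n) (by simpa using h7)) ?_
      have : (⨆ j : Fin n, Module.End.eigenspace H ((j : ℕ) : ℂ)) ≤
          ⨆ j : Fin (n + 1), Module.End.eigenspace H ((j : ℕ) : ℂ) :=
        iSup_le fun j => le_iSup_of_le j.castSucc (by simp)
      exact this hu
  have : (⨆ j : Fin n, Module.End.eigenspace H ((j : ℕ) : ℂ)) ≤
      ⨆ j : ℕ, Module.End.eigenspace H (j : ℂ) :=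
    iSup_le fun j => le_iSup_of_le (j : ℕ) le_rfl
  exact this (main n v hv (by simp [hn]))

lemma aux_option {α : Type*} [CompleteLattice α] [IsModularLattice α] (a : α) (t : ℕ → α)
    (ht : iSupIndep t) (ha : Disjoint a (⨆ j, t j)) :
    iSupIndep (fun o : Option ℕ => o.elim a t) := by
  rintro (_ | j)
  · refine ha.mono_right (iSup₂_le ?_)
    rintro (_ | k) hk
    · exact absurd rfl hk
    · exact le_iSup t k
  · have h1 : Disjoint (t j) ((⨆ (k) (_ : k ≠ j), t k) ⊔ a) := by
      refine (ht j).disjoint_sup_right_of_disjoint_sup_left (ha.symm.mono_left ?_)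
      exact sup_le (le_iSup t j) (iSup₂_le fun k _ => le_iSup t k)
    refine h1.mono_right (iSup₂_le ?_)
    rintro (_ | k) hk
    · exact le_sup_right
    · exact le_sup_of_le_left (le_iSup₂_of_le k (fun h => hk (by rw [h])) le_rfl)

lemma aux_main (hE : ∀ x, H (E x) = E (H x) + (2 : ℂ) • E x)
    (hF : ∀ x, H (F x) = F (H x) - (2 : ℂ) • F x)
    (hEF : ∀ x, E (F x) = F (E x) + H x) :
    iSupIndep (fun o : Option ℕ => o.elim (LinearMap.ker E)
        (fun j => Submodule.map F (Module.End.eigenspace H ((j : ℂ) + 2)))) ∧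
    (⨆ o : Option ℕ, o.elim (LinearMap.ker E)
        (fun j => Submodule.map F (Module.End.eigenspace H ((j : ℂ) + 2))))
      = ⨆ j : ℕ, Module.End.eigenspace H (j : ℂ) := by
  have hle : ∀ j : ℕ, Submodule.map F (Module.End.eigenspace H ((j : ℂ) + 2)) ≤
      Module.End.eigenspace H (j : ℂ) := by
    rintro j _ ⟨x, hx, rfl⟩
    have hx := Module.End.mem_eigenspace_iff.1 hx
    rw [Module.End.mem_eigenspace_iff, hF, hx, map_smul]
    module
  constructor
  · apply aux_option
    · exact ((Module.End.eigenspaces_iSupIndep H).comp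
        (f := fun j : ℕ => (j : ℂ)) Nat.cast_injective).mono hle
    · rw [← Submodule.map_iSup]
      set W := ⨆ j : ℕ, Module.End.eigenspace H ((j : ℂ) + 2) with hW
      have hmap : Set.MapsTo (E * F) W W := by
        have : W ≤ Submodule.comap (E * F) W := by
          refine iSup_le fun j x hx => ?_
          have hx := Module.End.mem_eigenspace_iff.1 hx
          refine Submodule.mem_iSup_of_mem j ?_
          rw [Module.End.mem_eigenspace_iff, Module.End.mul_apply, hE, hF, hx]
          simp
        exact this
      have hsurj : Set.SurjOn (E * F) W W := by
        have : W ≤ Submodule.map (E * F) W := by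
          refine iSup_le fun j x hx => ?_
          have hx := Module.End.mem_eigenspace_iff.1 hx
          obtain ⟨z, hz, hzx⟩ := aux_surj E H F hE hF hEF j x hx
          exact ⟨z, Submodule.mem_iSup_of_mem j (Module.End.mem_eigenspace_iff.2 hz), hzx⟩
        exact this
      have hinj := (LinearMap.injOn_iff_surjOn hmap).2 hsurj
      rw [Submodule.disjoint_def]
      rintro _ hx ⟨w, hw, rfl⟩
      have : w = 0 := hinj hw (zero_mem W) (by simpa using hx)
      simp [this]
  · rw [iSup_option_elim]
    apply le_antisymm
    · exact sup_le (fun v hv => aux_ker E H F hE hF hEF v hv) (iSup_mono hle)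
    · refine iSup_le fun j x hx => ?_
      have hx := Module.End.mem_eigenspace_iff.1 hx
      obtain ⟨z, hz, hzx⟩ := aux_surj E H F hE hF hEF j (E x) (by
        rw [hE, hx, map_smul]
        module)
      rw [← sub_add_cancel x (F z)]
      refine Submodule.add_mem_sup ?_ (Submodule.mem_iSup_of_mem j
        ⟨z, Module.End.mem_eigenspace_iff.2 hz, rfl⟩)
      rw [LinearMap.mem_ker, map_sub, hzx, sub_self]

end aux

/-- For an `sl₂`-triple `(e,h,f)` with even Dynkin grading in a finite-dimensional
semisimple complex Lie algebra, `𝔳 = ⊕_{j ≥ 0} 𝔤_j` decomposes as the internal direct sum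
`𝔳 = 𝔤^e ⊕ ⊕_{j ≥ 2} [f, 𝔤_j]`: the family consisting of the centralizer `𝔤^e` together
with the subspaces `[f, 𝔤_j]` (`j ≥ 2`) is independent and its supremum is `𝔳`. -/
theorem v_decomposition
    {L : Type*} [LieRing L] [LieAlgebra ℂ L] [FiniteDimensional ℂ L]
    [LieAlgebra.IsSemisimple ℂ L]
    (e h f : L) (he : e ≠ 0) (hh : h ≠ 0) (hf : f ≠ 0)
    (hhe : ⁅h, e⁆ = (2 : ℂ) • e) (hhf : ⁅h, f⁆ = -((2 : ℂ) • f)) (hef : ⁅e, f⁆ = h)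
    (heven : ∀ j : ℤ, Odd j →
      Module.End.eigenspace (LieAlgebra.ad ℂ L h) (j : ℂ) = ⊥) :
    iSupIndep (fun o : Option ℕ =>
      o.elim (LinearMap.ker (LieAlgebra.ad ℂ L e))
        (fun j => Submodule.map (LieAlgebra.ad ℂ L f)
          (Module.End.eigenspace (LieAlgebra.ad ℂ L h) (((j : ℤ) + 2 : ℤ) : ℂ)))) ∧
    (⨆ o : Option ℕ,
      o.elim (LinearMap.ker (LieAlgebra.ad ℂ L e))
        (fun j => Submodule.map (LieAlgebra.ad ℂ L f)
          (Module.End.eigenspace (LieAlgebra.ad ℂ L h) (((j : ℤ) + 2 : ℤ) : ℂ))))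
      = ⨆ j : ℕ, Module.End.eigenspace (LieAlgebra.ad ℂ L h) ((j : ℤ) : ℂ) := by
  have := aux_main (LieAlgebra.ad ℂ L e) (LieAlgebra.ad ℂ L h) (LieAlgebra.ad ℂ L f)
    (fun x => by
      simp only [LieAlgebra.ad_apply]
      rw [leibniz_lie h e x, hhe, smul_lie, add_comm])
    (fun x => by
      simp only [LieAlgebra.ad_apply]
      rw [leibniz_lie h f x, hhf, neg_lie, smul_lie]
      abel)
    (fun x => by
      simp only [LieAlgebra.ad_apply]
      rw [leibniz_lie e f x, hef, add_comm])
  push_cast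
  exact this
end

section
/- Let 𝔤 be a finite-dimensional semisimple Lie algebra over ℂ and (e,h,f) an sl₂-triple whose Dynkin grading is even (𝔤_j = 0 for all odd j). Set 𝔪 = ⊕_{j ≤ −2} 𝔤_j, 𝔳 = ⊕_{j ≥ 0} 𝔤_j, χ(x) = κ(x,e), and let I_χ ⊆ U(𝔤) be the left ideal generated by {a − χ(a)·1 : a ∈ 𝔪}, where elements of 𝔤 are viewed in U(𝔤) via the canonical embedding. Then U(𝔤) decomposes as an internal direct sum of vector spaces U(𝔤) = U(𝔳) ⊕ I_χ, where U(𝔳) denotes the subalgebra of U(𝔤) generated by the image of 𝔳. -/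
section EnvDecomp
attribute [local instance] LieRing.ofAssociativeRing

open UniversalEnvelopingAlgebra

theorem uea_adjoin_top {K L : Type*} [Field K] [LieRing L] [LieAlgebra K L] :
    Algebra.adjoin K (Set.range (ι K : L → UniversalEnvelopingAlgebra K L)) = ⊤ := by
  set S := Algebra.adjoin K (Set.range (ι K : L → UniversalEnvelopingAlgebra K L)) with hS
  let g : L →ₗ⁅K⁆ S :=
    { toFun := fun x => ⟨ι K x, Algebra.subset_adjoin ⟨x, rfl⟩⟩
      map_add' := fun x y => Subtype.ext (by simp)
      map_smul' := fun c x => Subtype.ext (by simp)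
      map_lie' := fun {x y} => Subtype.ext (by
        simp only [LieHom.map_lie, LieRing.of_associative_ring_bracket]; rfl) }
  have hcomp : S.val.comp (lift K g) = AlgHom.id K _ := by
    apply hom_ext
    ext x
    simp only [LieHom.comp_apply, AlgHom.coe_toLieHom, AlgHom.comp_apply, lift_ι_apply]
    rfl
  rw [eq_top_iff]
  intro x _
  have := congrArg (fun φ => φ x) hcomp
  simp only [AlgHom.comp_apply, AlgHom.id_apply] at this
  rw [← this]
  exact (lift K g x).2

theorem uea_induction {K L : Type*} [Field K] [LieRing L] [LieAlgebra K L]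
    (S : Submodule K (UniversalEnvelopingAlgebra K L)) (h1 : 1 ∈ S)
    (hS : ∀ x : L, ∀ u ∈ S, ι K x * u ∈ S) (u) : u ∈ S := by
  have key : ∀ a ∈ Algebra.adjoin K (Set.range (ι K : L → UniversalEnvelopingAlgebra K L)),
      ∀ s ∈ S, a * s ∈ S := by
    intro a ha
    induction ha using Algebra.adjoin_induction with
    | mem x hx => obtain ⟨x, rfl⟩ := hx; exact hS x
    | algebraMap r => intro s hs; rw [← Algebra.smul_def]; exact S.smul_mem _ hs
    | add x y _ _ hx hy => intro s hs; rw [add_mul]; exact S.add_mem (hx s hs) (hy s hs)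
    | mul x y _ _ hx hy => intro s hs; rw [mul_assoc]; exact hx _ (hy s hs)
  have := key u (by rw [uea_adjoin_top]; trivial) 1 h1
  simpa using this

/-- The action of `v` on `Hom(L, U(v))`. -/
noncomputable def homAct {K L : Type*} [Field K] [LieRing L] [LieAlgebra K L]
    (v : LieSubalgebra K L) :
    v →ₗ⁅K⁆ Module.End K (L →ₗ[K] UniversalEnvelopingAlgebra K v) where
  toFun x :=
    { toFun := fun F => (LinearMap.mulLeft K (ι K x)).comp F - F.comp (LieAlgebra.ad K L x)
      map_add' := fun F G => by ext z; simp [mul_add]; abel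
      map_smul' := fun c F => by ext z; simp [smul_sub] }
  map_add' x y := by ext F z; simp [add_mul]; abel
  map_smul' c x := by ext F z; simp [smul_sub]
  map_lie' {x y} := by
    ext F z
    simp only [LieRing.of_associative_ring_bracket, LinearMap.sub_apply, LinearMap.comp_apply,
      LinearMap.coe_mk, AddHom.coe_mk, Module.End.mul_apply, LinearMap.mulLeft_apply,
      LieHom.map_lie, LieAlgebra.ad_apply, LieSubalgebra.coe_bracket, map_sub]
    noncomm_ring

theorem matched_pair {K L : Type*} [Field K] [LieRing L] [LieAlgebra K L]
    (v : LieSubalgebra K L) (m : Submodule K L) (hc : IsCompl v.toSubmodule m)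
    (χ : L →ₗ[K] K) (hm : ∀ a ∈ m, ∀ b ∈ m, ⁅a, b⁆ ∈ m ∧ χ ⁅a, b⁆ = 0) :
    ∃ Φ : UniversalEnvelopingAlgebra K L →ₐ[K] Module.End K (UniversalEnvelopingAlgebra K v),
      (∀ a ∈ m, Φ (ι K a) 1 = algebraMap K _ (χ a)) ∧
      (∀ x : v, ∀ u, Φ (ι K (x : L)) u = ι K x * u) := by
  let A := UniversalEnvelopingAlgebra K v
  let pv := v.toSubmodule.projectionOnto m hc
  let pm := m.projection v.toSubmodule hc.symm
  let ρ : A →ₐ[K] Module.End K (L →ₗ[K] A) := lift K (homAct v)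
  let F1 : L →ₗ[K] A := ((ι K : v →ₗ⁅K⁆ A) : v →ₗ[K] A).comp pv +
    (Algebra.linearMap K A).comp (χ.comp pm)
  have hF1v : ∀ x : v, F1 x = ι K x := by
    intro x
    have h1 : pv (x : L) = x := Submodule.projectionOnto_apply_left hc x
    have h2 : pm (x : L) = 0 := by
      simp only [pm, Submodule.projection_apply]
      rw [(Submodule.projectionOnto_apply_eq_zero_iff hc.symm).2 x.2]; rfl
    simp [F1, h1, h2]
  have hF1m : ∀ a ∈ m, F1 a = algebraMap K A (χ a) := by
    intro a ha
    have h1 : pv a = 0 := (Submodule.projectionOnto_apply_eq_zero_iff hc).2 ha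
    have h2 : pm a = a := by
      simp only [pm, Submodule.projection_apply]
      exact congrArg Subtype.val (Submodule.projectionOnto_apply_left hc.symm ⟨a, ha⟩)
    simp [F1, h1, h2]
  let act : L → A → A := fun z u => ρ u F1 z
  have act_one : ∀ z, act z 1 = F1 z := fun z => by simp [act]
  have act_add : ∀ z u w, act z (u + w) = act z u + act z w := fun z u w => by simp [act]
  have act_smul : ∀ z (c : K) u, act z (c • u) = c • act z u := fun z u w => by simp [act]
  have act_addl : ∀ z w u, act (z + w) u = act z u + act w u := fun z u w => by simp [act]
  have act_smull : ∀ (c : K) z u, act (c • z) u = c • act z u := fun z u w => by simp [act]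
  have act_negl : ∀ z u, act (-z) u = - act z u := fun z u => by simp [act]
  have act_mul : ∀ (x : v) z u, act z (ι K x * u) = ι K x * act z u + act ⁅z, (x : L)⁆ u := by
    intro x z u
    have : ρ (ι K x) = homAct v x := lift_ι_apply K _ x
    rw [← lie_skew, act_negl]
    simp only [act, map_mul, this, Module.End.mul_apply]
    simp [homAct, sub_eq_add_neg]
  have act_v : ∀ u, ∀ x : v, act x u = ι K x * u := by
    intro u
    let S : Submodule K A :=
      { carrier := {u | ∀ x : v, act x u = ι K x * u}
        add_mem' := fun {a b} ha hb x => by rw [act_add, ha, hb, mul_add]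
        zero_mem' := fun x => by simp [act]
        smul_mem' := fun c u hu x => by rw [act_smul, hu, mul_smul_comm] }
    refine uea_induction S ?_ ?_ u
    · intro x; rw [act_one, hF1v, mul_one]
    · intro y u hu x
      rw [act_mul, hu x, ← LieSubalgebra.coe_bracket, hu, LieHom.map_lie,
        LieRing.of_associative_ring_bracket]
      noncomm_ring
  have decomp : ∀ z : L, ∃ x : v, ∃ a ∈ m, z = x + a := by
    intro z
    have : z ∈ v.toSubmodule ⊔ m := by rw [hc.sup_eq_top]; trivial
    obtain ⟨x, hx, a, ha, rfl⟩ := Submodule.mem_sup.1 this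
    exact ⟨⟨x, hx⟩, a, ha, rfl⟩
  have curv_v : ∀ (x : v) z u, act ⁅z, (x : L)⁆ u = act z (act x u) - act x (act z u) := by
    intro x z u
    rw [act_v, act_v, act_mul]; abel
  have curv : ∀ u, ∀ z w, act ⁅z, w⁆ u = act z (act w u) - act w (act z u) := by
    intro u
    let S : Submodule K A :=
      { carrier := {u | ∀ z w, act ⁅z, w⁆ u = act z (act w u) - act w (act z u)}
        add_mem' := fun {a b} ha hb z w => by simp only [act_add, ha z w, hb z w]; abel
        zero_mem' := fun x => by simp [act]
        smul_mem' := fun c u hu z w => by simp only [act_smul, hu z w, smul_sub] }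
    refine uea_induction S ?_ ?_ u
    · intro z w
      obtain ⟨x, a, ha, rfl⟩ := decomp z
      obtain ⟨y, b, hb, rfl⟩ := decomp w
      have e1 : act ⁅a, b⁆ 1 = act a (act b 1) - act b (act a 1) := by
        obtain ⟨h1, h2⟩ := hm a ha b hb
        rw [act_one, act_one, act_one, hF1m _ h1, h2, hF1m a ha, hF1m b hb,
          Algebra.algebraMap_eq_smul_one, Algebra.algebraMap_eq_smul_one,
          Algebra.algebraMap_eq_smul_one, act_smul, act_smul, act_one, act_one,
          hF1m a ha, hF1m b hb, Algebra.algebraMap_eq_smul_one,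
          Algebra.algebraMap_eq_smul_one, smul_smul, smul_smul, mul_comm]
        simp
      have e2 : act ⁅(x : L), b⁆ 1 = act x (act b 1) - act b (act x 1) := by
        rw [← lie_skew, act_negl, curv_v]; abel
      simp only [lie_add, add_lie, act_addl, act_add, e1, e2, curv_v]
      abel
    · intro x u hu z w
      have j : ⁅⁅z, w⁆, (x : L)⁆ = ⁅⁅z, (x : L)⁆, w⁆ + ⁅z, ⁅w, (x : L)⁆⁆ := by
        rw [lie_lie z w, ← lie_skew w ⁅z, (x : L)⁆]; abel
      simp only [act_mul, act_add, j, act_addl, hu _ _]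
      noncomm_ring
  let φ : L →ₗ⁅K⁆ Module.End K A :=
    { toFun := fun z =>
        { toFun := act z
          map_add' := act_add z
          map_smul' := act_smul z }
      map_add' := fun z w => by ext u; exact act_addl z w u
      map_smul' := fun c w => by ext u; exact act_smull c w u
      map_lie' := fun {z w} => by
        ext u
        rw [LieRing.of_associative_ring_bracket]
        exact curv u z w }
  have hφ : ∀ z u, lift K φ (ι K z) u = act z u := fun z u => by rw [lift_ι_apply]; rfl
  refine ⟨lift K φ, ?_, ?_⟩
  · intro a ha
    rw [hφ, act_one, hF1m a ha]
  · intro x u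
    rw [hφ, act_v]

theorem decomp_general {K L : Type*} [Field K] [LieRing L] [LieAlgebra K L]
    (v : LieSubalgebra K L) (m : Submodule K L) (hc : IsCompl v.toSubmodule m)
    (χ : L →ₗ[K] K) (hm : ∀ a ∈ m, ∀ b ∈ m, ⁅a, b⁆ ∈ m ∧ χ ⁅a, b⁆ = 0) :
    IsCompl (Subalgebra.toSubmodule (Algebra.adjoin K
        (⇑(ι K : L →ₗ⁅K⁆ UniversalEnvelopingAlgebra K L) '' (v : Set L))))
      (Submodule.restrictScalars K (Submodule.span (UniversalEnvelopingAlgebra K L)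
        {x : UniversalEnvelopingAlgebra K L | ∃ a ∈ m,
          x = ι K a - algebraMap K (UniversalEnvelopingAlgebra K L) (χ a)})) := by
  obtain ⟨Φ, hΦm, hΦv⟩ := matched_pair v m hc χ hm
  set Uv := Algebra.adjoin K
        (⇑(ι K : L →ₗ⁅K⁆ UniversalEnvelopingAlgebra K L) '' (v : Set L)) with hUv
  set I := Submodule.span (UniversalEnvelopingAlgebra K L)
        {x : UniversalEnvelopingAlgebra K L | ∃ a ∈ m,
          x = ι K a - algebraMap K (UniversalEnvelopingAlgebra K L) (χ a)} with hI
  let j : UniversalEnvelopingAlgebra K v →ₐ[K] UniversalEnvelopingAlgebra K L :=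
    lift K ((ι K : L →ₗ⁅K⁆ UniversalEnvelopingAlgebra K L).comp v.incl)
  have hj : ∀ x : v, j (ι K x) = ι K (x : L) := fun x => by
    simp only [j, lift_ι_apply]; rfl
  have hΦj : ∀ u, Φ (j u) 1 = u := by
    have H : ∀ u, ∀ w, Φ (j u) w = u * w := by
      intro u
      let S : Submodule K (UniversalEnvelopingAlgebra K v) :=
        { carrier := {u | ∀ w, Φ (j u) w = u * w}
          add_mem' := fun {a b} ha hb w => by
            rw [map_add, map_add, LinearMap.add_apply, ha, hb, add_mul]
          zero_mem' := fun w => by simp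
          smul_mem' := fun c u hu w => by
            rw [map_smul, map_smul, LinearMap.smul_apply, hu, smul_mul_assoc] }
      refine uea_induction S ?_ ?_ u
      · intro w; simp
      · intro x u hu w
        rw [map_mul, map_mul, hj, Module.End.mul_apply, hu, hΦv, mul_assoc]
    intro u; rw [H, mul_one]
  have hΦI : ∀ u ∈ I, Φ u 1 = 0 := by
    intro u hu
    induction hu using Submodule.span_induction with
    | mem x hx =>
      obtain ⟨a, ha, rfl⟩ := hx
      rw [map_sub, LinearMap.sub_apply, hΦm a ha, AlgHom.commutes,
        Module.algebraMap_end_apply, Algebra.algebraMap_eq_smul_one, sub_self]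
    | zero => simp
    | add x y _ _ hx hy => rw [map_add, LinearMap.add_apply, hx, hy, add_zero]
    | smul a x _ hx => rw [smul_eq_mul, map_mul, Module.End.mul_apply, hx, map_zero]
  have hrange : ∀ u ∈ Uv, ∃ w, j w = u := by
    intro u hu
    have : Uv ≤ j.range := by
      rw [hUv]; apply Algebra.adjoin_le
      rintro _ ⟨x, hx, rfl⟩
      exact ⟨ι K ⟨x, hx⟩, hj ⟨x, hx⟩⟩
    exact this hu
  constructor
  · rw [Submodule.disjoint_def]
    intro u hu hu'
    obtain ⟨w, rfl⟩ := hrange u hu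
    have := hΦI _ hu'
    rw [hΦj] at this
    rw [this, map_zero]
  · rw [codisjoint_iff, eq_top_iff]
    set W := Subalgebra.toSubmodule Uv ⊔ Submodule.restrictScalars K I with hW
    have hUW : ∀ u ∈ Uv, u ∈ W := fun u hu => Submodule.mem_sup_left hu
    have hIW : ∀ u ∈ I, u ∈ W := fun u hu => Submodule.mem_sup_right hu
    have hjU : ∀ w, j w ∈ Uv := by
      intro w
      refine uea_induction ((Subalgebra.toSubmodule Uv).comap j.toLinearMap) ?_ ?_ w
      · simp only [Submodule.mem_comap, AlgHom.toLinearMap_apply, map_one]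
        exact Uv.one_mem
      · intro x u hu
        simp only [Submodule.mem_comap, AlgHom.toLinearMap_apply, map_mul, hj] at hu ⊢
        exact Uv.mul_mem (Algebra.subset_adjoin ⟨x, x.2, rfl⟩) hu
    have hvW : ∀ x ∈ v, ∀ u ∈ W, ι K x * u ∈ W := by
      intro x hx u hu
      obtain ⟨p, hp, q, hq, rfl⟩ := Submodule.mem_sup.1 hu
      rw [mul_add]
      exact W.add_mem (hUW _ (Uv.mul_mem (Algebra.subset_adjoin ⟨x, hx, rfl⟩) hp))
        (hIW _ (I.smul_mem (ι K x) hq))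
    have decomp : ∀ z : L, ∃ x : v, ∃ a ∈ m, z = x + a := by
      intro z
      have : z ∈ v.toSubmodule ⊔ m := by rw [hc.sup_eq_top]; trivial
      obtain ⟨x, hx, a, ha, rfl⟩ := Submodule.mem_sup.1 this
      exact ⟨⟨x, hx⟩, a, ha, rfl⟩
    have hLj : ∀ w, ∀ z : L, ι K z * j w ∈ W := by
      intro w
      let S : Submodule K (UniversalEnvelopingAlgebra K v) :=
        { carrier := {u | ∀ z : L, ι K z * j u ∈ W}
          add_mem' := fun {a b} ha hb z => by
            rw [map_add, mul_add]; exact W.add_mem (ha z) (hb z)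
          zero_mem' := fun w => by simp
          smul_mem' := fun c u hu w => by
            rw [map_smul, mul_smul_comm]; exact W.smul_mem _ (hu w) }
      refine uea_induction S ?_ ?_ w
      · intro z
        obtain ⟨x, a, ha, rfl⟩ := decomp z
        rw [map_one, mul_one, map_add]
        refine W.add_mem (hUW _ (Algebra.subset_adjoin ⟨x, x.2, rfl⟩)) ?_
        rw [← sub_add_cancel (ι K a) (algebraMap K _ (χ a))]
        exact W.add_mem (hIW _ (Submodule.subset_span ⟨a, ha, rfl⟩)) (hUW _ (Uv.algebraMap_mem _))
      · intro x u hu z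
        have : ι K z * j (ι K x * u) = ι K (x : L) * (ι K z * j u) + ι K ⁅z, (x : L)⁆ * j u := by
          rw [map_mul, hj, LieHom.map_lie, LieRing.of_associative_ring_bracket]
          noncomm_ring
        rw [this]
        exact W.add_mem (hvW _ x.2 _ (hu z)) (hu _)
    intro u _
    refine uea_induction W (hUW _ Uv.one_mem) ?_ u
    intro z u hu
    obtain ⟨p, hp, q, hq, rfl⟩ := Submodule.mem_sup.1 hu
    rw [mul_add]
    obtain ⟨w, rfl⟩ := hrange p hp
    exact W.add_mem (hLj w z) (hIW _ (I.smul_mem (ι K z) hq))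

theorem ad_comm {L : Type*} [LieRing L] [LieAlgebra ℂ L] (x y : L) :
    LieAlgebra.ad ℂ L x * LieAlgebra.ad ℂ L y - LieAlgebra.ad ℂ L y * LieAlgebra.ad ℂ L x =
      LieAlgebra.ad ℂ L ⁅x, y⁆ := by
  rw [LieHom.map_lie, LieRing.of_associative_ring_bracket]

end EnvDecomp


section SlTwo

theorem comm_semisimple {R : Type*} [CommRing R] [Algebra ℂ R] (D h : R) (n : ℕ)
    (h1 : ∏ i ∈ Finset.range n, (D - (h + 2 * (i : R) + 1) ^ 2) = 0)
    (h2 : ∏ i ∈ Finset.range n, (D - (h - 2 * (i : R) - 1) ^ 2) = 0) :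
    ∏ k ∈ Finset.Icc (-(n : ℤ)) n, (h - (k : R)) = 0 := by
  classical
  set P := ∏ k ∈ Finset.Icc (-(n : ℤ)) n, (h - (k : R)) with hP
  have unit_int : ∀ k : ℤ, k ≠ 0 → IsUnit (k : R) := by
    intro k hk
    have : (k : R) = algebraMap ℂ R k := by simp
    rw [this]
    exact (IsUnit.mk0 _ (by exact_mod_cast hk)).map _
  let J : Ideal R := LinearMap.ker (LinearMap.toSpanSingleton R R P)
  have hJ : ∀ s, s ∈ J ↔ s * P = 0 := fun s => by simp [J]
  suffices J = ⊤ by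
    have : (1 : R) ∈ J := by rw [this]; trivial
    rw [hJ] at this; simpa using this
  by_contra hne
  obtain ⟨M, hM, hJM⟩ := Ideal.exists_le_maximal J hne
  have hpr := hM.isPrime
  have int_notin : ∀ k : ℤ, (k : R) ∈ M → k = 0 := by
    intro k hk
    by_contra h0
    exact hM.ne_top (Ideal.eq_top_of_isUnit_mem _ hk (unit_int k h0))
  have m1 : ∏ i ∈ Finset.range n, (D - (h + 2 * (i : R) + 1) ^ 2) ∈ M := by rw [h1]; exact M.zero_mem
  have m2 : ∏ i ∈ Finset.range n, (D - (h - 2 * (i : R) - 1) ^ 2) ∈ M := by rw [h2]; exact M.zero_mem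
  rw [hpr.prod_mem_iff] at m1 m2
  obtain ⟨i, hi, m1⟩ := m1
  obtain ⟨j, hj, m2⟩ := m2
  have canc : ∀ (k : ℤ) (y : R), k ≠ 0 → (k : R) * y ∈ M → y ∈ M := by
    intro k y hk hy
    rcases hpr.mem_or_mem hy with h | h
    · exact absurd (int_notin k h) hk
    · exact h
  have hk : h - (((j : ℤ) - i : ℤ) : R) ∈ M := by
    apply canc (4 * (i + j + 1)) _ (by positivity)
    have := M.sub_mem m2 m1
    convert this using 1
    push_cast; ring
  have u1 : ∀ i' : ℕ, D - (h + 2 * (i' : R) + 1) ^ 2 ∈ M → i' = i := by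
    intro i' hi'
    by_contra hne
    have h3 : h - ((-(i + i' + 1) : ℤ) : R) ∈ M := by
      apply canc (4 * ((i : ℤ) - i')) _ (by omega)
      have := M.sub_mem hi' m1
      convert this using 1
      push_cast; ring
    have h4 := M.sub_mem h3 hk
    have h5 := int_notin (((j : ℤ) - i) + (i + i' + 1)) (by convert h4 using 1; push_cast; ring)
    omega
  have u2 : ∀ i' : ℕ, D - (h - 2 * (i' : R) - 1) ^ 2 ∈ M → i' = j := by
    intro i' hi'
    by_contra hne
    have h3 : h - (((j + i' + 1) : ℤ) : R) ∈ M := by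
      apply canc (4 * ((i' : ℤ) - j)) _ (by omega)
      have := M.sub_mem hi' m2
      convert this using 1
      push_cast; ring
    have h4 := M.sub_mem hk h3
    have h5 := int_notin (((j : ℤ) + i' + 1) - (j - i)) (by convert h4 using 1; push_cast; ring)
    omega
  set s1 := ∏ i' ∈ (Finset.range n).erase i, (D - (h + 2 * (i' : R) + 1) ^ 2) with hs1
  set s2 := ∏ i' ∈ (Finset.range n).erase j, (D - (h - 2 * (i' : R) - 1) ^ 2) with hs2
  have hs1M : s1 ∉ M := by
    rw [hs1, hpr.prod_mem_iff]
    rintro ⟨i', hi', h⟩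
    exact (Finset.mem_erase.1 hi').1 (u1 _ h)
  have hs2M : s2 ∉ M := by
    rw [hs2, hpr.prod_mem_iff]
    rintro ⟨i', hi', h⟩
    exact (Finset.mem_erase.1 hi').1 (u2 _ h)
  rw [← Finset.mul_prod_erase _ _ hi, ← hs1] at h1
  rw [← Finset.mul_prod_erase _ _ hj, ← hs2] at h2
  have hs : s1 * s2 * (h - (((j : ℤ) - i : ℤ) : R)) = 0 := by
    have : ((4 * (i + j + 1) : ℤ) : R) * (s1 * s2 * (h - (((j : ℤ) - i : ℤ) : R))) = 0 := by
      have e : ((4 * (i + j + 1) : ℤ) : R) * (s1 * s2 * (h - (((j : ℤ) - i : ℤ) : R))) =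
        s1 * ((D - (h - 2 * (j : R) - 1) ^ 2) * s2) - s2 * ((D - (h + 2 * (i : R) + 1) ^ 2) * s1) := by
        push_cast; ring
      rw [e, h1, h2]; simp
    exact (unit_int _ (by positivity)).mul_right_eq_zero.1 this
  have : s1 * s2 ∈ J := by
    rw [hJ, hP]
    have hmem : (j : ℤ) - i ∈ Finset.Icc (-(n : ℤ)) n := by
      simp only [Finset.mem_range] at hi hj
      simp only [Finset.mem_Icc]; omega
    rw [← Finset.mul_prod_erase _ _ hmem, ← mul_assoc, hs, zero_mul]
  rcases hpr.mem_or_mem (hJM this) with h | h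
  · exact hs1M h
  · exact hs2M h

theorem pow_nilp {V : Type*} [AddCommGroup V] [Module ℂ V] [FiniteDimensional ℂ V]
    (H E : Module.End ℂ V) (c : ℂ) (hc : c ≠ 0) (hE : H * E = E * (H + algebraMap ℂ _ c)) :
    (∀ n : ℕ, H * E ^ n = E ^ n * (H + algebraMap ℂ _ (n * c))) ∧ ∃ N : ℕ, ∀ n ≥ N, E ^ n = 0 := by
  have key : ∀ n : ℕ, H * E ^ n = E ^ n * (H + algebraMap ℂ _ (n * c)) := by
    intro n
    induction n with
    | zero => simp
    | succ n ih =>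
      have hcomm : E * algebraMap ℂ (Module.End ℂ V) (n * c) =
        algebraMap ℂ (Module.End ℂ V) (n * c) * E := (Algebra.commutes _ _).symm
      have e : algebraMap ℂ (Module.End ℂ V) ((n + 1 : ℕ) * c) =
        algebraMap ℂ _ c + algebraMap ℂ _ (n * c) := by
        rw [← map_add]; congr 1; push_cast; ring
      rw [pow_succ, ← mul_assoc, ih, mul_assoc, add_mul, hE, ← hcomm, ← mul_add, e, mul_assoc,
        add_assoc]
  refine ⟨key, ?_⟩
  suffices ∃ N : ℕ, E ^ N = 0 by
    obtain ⟨N, hN⟩ := this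
    exact ⟨N, fun n hn => pow_eq_zero_of_le hn hN⟩
  by_contra hno
  push Not at hno
  let T : Module.End ℂ (Module.End ℂ V) := LinearMap.mulLeft ℂ H - LinearMap.mulRight ℂ H
  have hT : ∀ n : ℕ, T.HasEigenvector (n * c) (E ^ n) := by
    intro n
    refine ⟨?_, hno n⟩
    rw [Module.End.mem_eigenspace_iff]
    simp only [T, LinearMap.sub_apply, LinearMap.mulLeft_apply, LinearMap.mulRight_apply, key,
      mul_add, ← Algebra.commutes, ← Algebra.smul_def]
    abel
  have hinj : Function.Injective (fun n : ℕ => (n : ℂ) * c) := by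
    intro a b hab
    exact_mod_cast mul_right_cancel₀ hc hab
  have := T.finite_hasEigenvalue
  refine Set.infinite_of_injective_forall_mem hinj (fun n => ?_) this
  exact Module.End.hasEigenvalue_of_hasEigenvector (hT n)

theorem sl2_semisimple {V : Type*} [AddCommGroup V] [Module ℂ V] [FiniteDimensional ℂ V]
    (H E F : Module.End ℂ V) (hE : H * E - E * H = 2 * E) (hF : H * F - F * H = - (2 * F))
    (hEF : E * F - F * E = H) :
    ⨆ k : ℤ, Module.End.eigenspace H (k : ℂ) = ⊤ := by
  have c2 : algebraMap ℂ (Module.End ℂ V) 2 = 2 := map_ofNat _ 2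
  obtain ⟨kE, N1, hN1⟩ := pow_nilp H E 2 (by norm_num) (by
    rw [c2]; rw [sub_eq_iff_eq_add] at hE; rw [hE]; noncomm_ring)
  obtain ⟨kF, N2, hN2⟩ := pow_nilp H F (-2) (by norm_num) (by
    rw [map_neg, c2]; rw [sub_eq_iff_eq_add] at hF; rw [hF]; noncomm_ring)
  set D : Module.End ℂ V := 4 * (F * E) + (H + 1) ^ 2 with hD
  have hE' : H * E = E * H + 2 * E := by rw [← hE]; abel
  have hF' : H * F = F * H - 2 * F := by rw [sub_eq_add_neg, ← hF]; abel
  have hEF' : E * F = F * E + H := by rw [← hEF]; abel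
  have hFEH : H * (F * E) = (F * E) * H := by
    rw [← mul_assoc, hF', sub_mul, mul_assoc, hE', mul_assoc]
    noncomm_ring
  have hDH : D * H = H * D := by
    have h4 : H * (4 * (F * E)) = 4 * (F * E) * H := by
      rw [mul_assoc, ← hFEH]; noncomm_ring
    rw [hD, mul_add, add_mul, h4]; noncomm_ring
  have hDE : D * E = E * D := by
    have a1 : E * (4 * (F * E)) = 4 * (F * E * E) + 4 * (H * E) := by
      have : E * (4 * (F * E)) = 4 * (E * F * E) := by noncomm_ring
      rw [this, hEF']; noncomm_ring
    have a2 : E * H = H * E - 2 * E := by rw [hE']; abel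
    have a3 : E * (H + 1) ^ 2 = (H - 1) ^ 2 * E := by
      have : E * (H + 1) = (H - 1) * E := by rw [mul_add, a2]; noncomm_ring
      rw [pow_two, ← mul_assoc, this, mul_assoc, this]; noncomm_ring
    rw [hD, mul_add, add_mul, a1, a3]; noncomm_ring
  have hDF : D * F = F * D := by
    have a1 : 4 * (F * E) * F = F * (4 * (F * E)) + 4 * (F * H) := by
      have : 4 * (F * E) * F = 4 * (F * (E * F)) := by noncomm_ring
      rw [this, hEF']; noncomm_ring
    have a3 : (H + 1) ^ 2 * F = F * (H - 1) ^ 2 := by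
      have : (H + 1) * F = F * (H - 1) := by rw [add_mul, hF']; noncomm_ring
      rw [pow_two, mul_assoc, this, ← mul_assoc, this]; noncomm_ring
    rw [hD, mul_add, add_mul, a1, a3]; noncomm_ring
  have hcommS : ∀ a ∈ ({D, H} : Set (Module.End ℂ V)), ∀ b ∈ ({D, H} : Set (Module.End ℂ V)),
      a * b = b * a := by
    rintro a (rfl | rfl) b (rfl | rfl) <;> first | rfl | exact hDH | exact hDH.symm
  letI : CommRing (Algebra.adjoin ℂ ({D, H} : Set (Module.End ℂ V))) :=
    Algebra.adjoinCommRingOfComm ℂ hcommS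
  let S := Algebra.adjoin ℂ ({D, H} : Set (Module.End ℂ V))
  let D' : S := ⟨D, Algebra.subset_adjoin (by simp)⟩
  let H' : S := ⟨H, Algebra.subset_adjoin (by simp)⟩
  let val : S →+* Module.End ℂ V := S.val.toRingHom
  have hval : Function.Injective val := Subtype.val_injective
  have vD : val D' = D := rfl
  have vH : val H' = H := rfl
  have pD : ∀ n : ℕ, D * E ^ n = E ^ n * D := fun n => ((show Commute D E from hDE).pow_right n)
  have pDF : ∀ n : ℕ, D * F ^ n = F ^ n * D := fun n => ((show Commute D F from hDF).pow_right n)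
  have f1 : ∀ n : ℕ, val (∏ i ∈ Finset.range n, (D' - (H' + 2 * (i : S) + 1) ^ 2)) =
      4 ^ n * (F ^ n * E ^ n) := by
    intro n
    induction n with
    | zero => simp
    | succ n ih =>
      rw [Finset.prod_range_succ, map_mul, ih]
      simp only [map_sub, map_add, map_mul, map_pow, map_natCast, map_one, map_ofNat, vD, vH]
      have e1 : (H + 1) * E ^ n = E ^ n * (H + 2 * (n : Module.End ℂ V) + 1) := by
        rw [add_mul, kE, map_mul, c2, map_natCast, (Nat.cast_commute n (2 : Module.End ℂ V)).eq]
        noncomm_ring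
      have e2 : (D - (H + 1) ^ 2) * E ^ n = E ^ n * (D - (H + 2 * (n : Module.End ℂ V) + 1) ^ 2) := by
        rw [sub_mul, pD, pow_two, mul_assoc, e1, ← mul_assoc, e1, mul_sub, pow_two, mul_assoc]
      rw [mul_assoc, mul_assoc, ← e2]
      have e3 : D - (H + 1) ^ 2 = 4 * (F * E) := by rw [hD]; abel
      rw [e3, pow_succ 4, pow_succ F, pow_succ' E]
      have : F ^ n * (4 * (F * E) * E ^ n) = 4 * (F ^ n * F * (E * E ^ n)) := by noncomm_ring
      rw [this]; simp only [mul_assoc]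
  have f2 : ∀ n : ℕ, val (∏ i ∈ Finset.range n, (D' - (H' - 2 * (i : S) - 1) ^ 2)) =
      4 ^ n * (E ^ n * F ^ n) := by
    intro n
    induction n with
    | zero => simp
    | succ n ih =>
      rw [Finset.prod_range_succ, map_mul, ih]
      simp only [map_sub, map_mul, map_pow, map_natCast, map_one, map_ofNat, vD, vH]
      have e1 : (H - 1) * F ^ n = F ^ n * (H - 2 * (n : Module.End ℂ V) - 1) := by
        rw [sub_mul, kF, map_mul, map_neg, c2, map_natCast, mul_neg,
          (Nat.cast_commute n (2 : Module.End ℂ V)).eq]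
        noncomm_ring
      have e2 : (D - (H - 1) ^ 2) * F ^ n = F ^ n * (D - (H - 2 * (n : Module.End ℂ V) - 1) ^ 2) := by
        rw [sub_mul, pDF, pow_two, mul_assoc, e1, ← mul_assoc, e1, mul_sub (F ^ n) D, pow_two, mul_assoc]
      rw [mul_assoc, mul_assoc, ← e2]
      have e3 : D - (H - 1) ^ 2 = 4 * (E * F) := by rw [hD, hEF']; noncomm_ring
      rw [e3, pow_succ 4, pow_succ E, pow_succ' F]
      have : E ^ n * (4 * (E * F) * F ^ n) = 4 * (E ^ n * E * (F * F ^ n)) := by noncomm_ring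
      rw [this]; simp only [mul_assoc]
  have main := comm_semisimple D' H' (N1 + N2)
    (hval (by rw [f1, hN1 _ (by omega), map_zero]; simp))
    (hval (by rw [f2, hN2 _ (by omega), map_zero]; simp))
  set n := N1 + N2
  have hk : ∀ s : Finset ℤ, LinearMap.ker (val (∏ k ∈ s, (H' - (k : S)))) ≤
      ⨆ k : ℤ, Module.End.eigenspace H (k : ℂ) := by
    have hpoly : ∀ s : Finset ℤ, val (∏ k ∈ s, (H' - (k : S))) =
        Polynomial.aeval H (∏ k ∈ s, (Polynomial.X - Polynomial.C (k : ℂ))) := by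
      intro s
      induction s using Finset.induction_on with
      | empty => simp
      | insert k s hks ih =>
        rw [Finset.prod_insert hks, Finset.prod_insert hks, map_mul, map_mul, ih]
        congr 1
        simp [vH]
    intro s
    rw [hpoly]
    induction s using Finset.induction_on with
    | empty =>
      intro x hx
      have hx0 : x = 0 := by simpa using hx
      rw [hx0]; exact Submodule.zero_mem _
    | insert k s hks ih =>
      rw [Finset.prod_insert hks, ← Polynomial.sup_ker_aeval_eq_ker_aeval_mul_of_coprime]
      · refine sup_le ?_ ih
        refine le_trans ?_ (le_iSup (fun k : ℤ => Module.End.eigenspace H (k : ℂ)) k)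
        intro x hx
        rw [Module.End.mem_eigenspace_iff]
        rw [Int.cast_smul_eq_zsmul]
        simpa [sub_eq_zero] using hx
      · refine IsCoprime.prod_right fun l hl => ?_
        apply Polynomial.isCoprime_X_sub_C_of_isUnit_sub
        apply IsUnit.mk0
        rw [sub_ne_zero]
        have : k ≠ l := fun h => hks (h ▸ hl)
        exact_mod_cast this
  rw [eq_top_iff]
  refine le_trans ?_ (hk (Finset.Icc (-(n : ℤ)) n))
  rw [main, map_zero, LinearMap.ker_zero]

theorem lie_mem_eig {L : Type*} [LieRing L] [LieAlgebra ℂ L] (h x y : L) (p q : ℂ)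
    (hx : x ∈ Module.End.eigenspace (LieAlgebra.ad ℂ L h) p)
    (hy : y ∈ Module.End.eigenspace (LieAlgebra.ad ℂ L h) q) :
    ⁅x, y⁆ ∈ Module.End.eigenspace (LieAlgebra.ad ℂ L h) (p + q) := by
  rw [Module.End.mem_eigenspace_iff, LieAlgebra.ad_apply] at *
  rw [leibniz_lie, hx, hy, smul_lie, lie_smul, add_smul]

theorem iSup_bracket {L ι : Type*} [LieRing L] [LieAlgebra ℂ L] (P : ι → Submodule ℂ L)
    (Q : Submodule ℂ L) (H : ∀ i j, ∀ x ∈ P i, ∀ y ∈ P j, ⁅x, y⁆ ∈ Q) :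
    ∀ x ∈ ⨆ i, P i, ∀ y ∈ ⨆ i, P i, ⁅x, y⁆ ∈ Q := by
  intro x hx
  induction hx using Submodule.iSup_induction' with
  | mem i x hx =>
    intro y hy
    induction hy using Submodule.iSup_induction' with
    | mem j y hy => exact H i j x hx y hy
    | zero => simp
    | add y z _ _ h1 h2 => rw [lie_add]; exact Q.add_mem h1 h2
  | zero => simp
  | add w z _ _ h1 h2 => intro y hy; rw [add_lie]; exact Q.add_mem (h1 y hy) (h2 y hy)

end SlTwo


/-- For an `sl₂`-triple `(e,h,f)` with even Dynkin grading in a finite-dimensional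
semisimple complex Lie algebra, with `𝔪 = ⊕_{j ≤ −2} 𝔤_j`, `𝔳 = ⊕_{j ≥ 0} 𝔤_j`,
`χ(x) = κ(x,e)` and `I_χ ⊆ U(𝔤)` the left ideal generated by `{a − χ(a)·1 : a ∈ 𝔪}`,
the universal enveloping algebra decomposes as an internal direct sum of vector spaces
`U(𝔤) = U(𝔳) ⊕ I_χ`, where `U(𝔳)` is the subalgebra generated by the image of `𝔳`. -/
theorem enveloping_algebra_decomposition
    {L : Type*} [LieRing L] [LieAlgebra ℂ L] [FiniteDimensional ℂ L]
    [LieAlgebra.IsSemisimple ℂ L]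
    (e h f : L) (he : e ≠ 0) (hh : h ≠ 0) (hf : f ≠ 0)
    (hhe : ⁅h, e⁆ = (2 : ℂ) • e) (hhf : ⁅h, f⁆ = -((2 : ℂ) • f)) (hef : ⁅e, f⁆ = h)
    (heven : ∀ j : ℤ, Odd j →
      Module.End.eigenspace (LieAlgebra.ad ℂ L h) (j : ℂ) = ⊥)
    (m v : Submodule ℂ L)
    (hm : m = ⨆ j : ℕ,
      Module.End.eigenspace (LieAlgebra.ad ℂ L h) ((-(j : ℤ) - 2 : ℤ) : ℂ))
    (hv : v = ⨆ j : ℕ,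
      Module.End.eigenspace (LieAlgebra.ad ℂ L h) ((j : ℤ) : ℂ))
    (Uv : Subalgebra ℂ (UniversalEnvelopingAlgebra ℂ L))
    (hUv : Uv = Algebra.adjoin ℂ (⇑(UniversalEnvelopingAlgebra.ι ℂ) '' (v : Set L)))
    (Iχ : Submodule ℂ (UniversalEnvelopingAlgebra ℂ L))
    (hIχ : Iχ = Submodule.restrictScalars ℂ
      (Submodule.span (UniversalEnvelopingAlgebra ℂ L)
        {x : UniversalEnvelopingAlgebra ℂ L | ∃ a ∈ m,
          x = UniversalEnvelopingAlgebra.ι ℂ a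
            - algebraMap ℂ (UniversalEnvelopingAlgebra ℂ L) (killingForm ℂ L a e)})) :
    IsCompl (Subalgebra.toSubmodule Uv) Iχ := by
  have hss : ⨆ k : ℤ, Module.End.eigenspace (LieAlgebra.ad ℂ L h) (k : ℂ) = ⊤ := by
    apply sl2_semisimple _ (LieAlgebra.ad ℂ L e) (LieAlgebra.ad ℂ L f)
    · rw [ad_comm, hhe, map_smul, two_smul, two_mul]
    · rw [ad_comm, hhf, map_neg, map_smul,
        two_smul, two_mul]
    · rw [ad_comm, hef]
  have hcompl : IsCompl v m := by
    constructor
    · have hind := (Module.End.eigenspaces_iSupIndep (LieAlgebra.ad ℂ L h))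
      have := hind.disjoint_biSup_biSup (s := Set.range fun j : ℕ => ((j : ℤ) : ℂ))
        (t := Set.range fun j : ℕ => ((-(j : ℤ) - 2 : ℤ) : ℂ)) (by
          rw [Set.disjoint_left]
          rintro _ ⟨i, rfl⟩ ⟨j, hj⟩
          have : (-(j : ℤ) - 2 : ℤ) = (i : ℤ) := Int.cast_injective (α := ℂ) hj
          omega)
      rw [iSup_range, iSup_range] at this
      rw [hm, hv]; exact this
    · rw [codisjoint_iff, eq_top_iff, ← hss]
      refine iSup_le fun k => ?_
      rcases lt_trichotomy k (-1) with hk | hk | hk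
      · refine le_trans ?_ le_sup_right
        rw [hm]
        refine le_trans (le_of_eq ?_) (le_iSup _ (-k - 2).toNat)
        congr 2; omega
      · rw [heven k (by rw [hk]; decide)]; exact bot_le
      · refine le_trans ?_ le_sup_left
        rw [hv]
        refine le_trans (le_of_eq ?_) (le_iSup _ k.toNat)
        congr 2; omega
  have hvv : ∀ x ∈ v, ∀ y ∈ v, ⁅x, y⁆ ∈ v := by
    rw [hv]
    refine iSup_bracket _ _ fun i j x hx y hy => ?_
    refine Submodule.mem_iSup_of_mem (i + j) ?_
    have := lie_mem_eig h x y _ _ hx hy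
    convert this using 2
    push_cast; ring
  have hmm : ∀ x ∈ m, ∀ y ∈ m, ⁅x, y⁆ ∈ m := by
    rw [hm]
    refine iSup_bracket _ _ fun i j x hx y hy => ?_
    refine Submodule.mem_iSup_of_mem (i + j + 2) ?_
    have := lie_mem_eig h x y _ _ hx hy
    convert this using 2
    push_cast; ring
  let χ : L →ₗ[ℂ] ℂ := (killingForm ℂ L).flip e
  have hχ : ∀ x ∈ m, ∀ y ∈ m, ⁅x, y⁆ ∈ LinearMap.ker χ := by
    rw [hm]
    refine iSup_bracket _ _ fun i j x hx y hy => ?_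
    have := lie_mem_eig h x y _ _ hx hy
    rw [Module.End.mem_eigenspace_iff, LieAlgebra.ad_apply] at this
    have h1 : killingForm ℂ L ⁅⁅x, y⁆, h⁆ e = killingForm ℂ L ⁅x, y⁆ ⁅h, e⁆ :=
      LieModule.traceForm_apply_lie_apply ℂ L L _ _ _
    rw [← lie_skew, this, hhe, map_neg, map_smul, map_smul, LinearMap.neg_apply,
      LinearMap.smul_apply, smul_eq_mul, smul_eq_mul] at h1
    have h2 : ((i + j + 2 : ℕ) : ℂ) * killingForm ℂ L ⁅x, y⁆ e = 0 := by
      push_cast at h1 ⊢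
      linear_combination h1
    rcases mul_eq_zero.1 h2 with h3 | h3
    · norm_cast at h3
    · exact h3
  let vL : LieSubalgebra ℂ L := { v with lie_mem' := fun {x y} hx hy => hvv x hx y hy }
  have := decomp_general vL m hcompl χ (fun a ha b hb => ⟨hmm a ha b hb, hχ a ha b hb⟩)
  rw [hUv, hIχ]
  exact this
end
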